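/- (Douglas–Rudin) Let φ ∈ L^∞(𝕋) satisfy |φ(e^{iθ})| = 1 for almost every e^{iθ} ∈ 𝕋, and let ε > 0. Then there exist inner functions ω₁ and ω₂ (which may be taken to be Blaschke products) such that ess sup_{θ} |φ(e^{iθ}) − ω₁(e^{iθ})/ω₂(e^{iθ})| < ε. -/

import Mathlib

open Complex Metric Set Filter MeasureTheory
open scoped Topology Real

/-- A (possibly infinite) Blaschke product
`c z^m ∏ᵢ (|aᵢ|/aᵢ)·(aᵢ - z)/(1 - conj aᵢ · z)`. -/
noncomputable def blaschkeProd (m : ℕ) (c : ℂ) {ι : Type} (a : ι → ℂ) : ℂ → ℂ :=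
  fun z => c * z ^ m *
    ∏' i, ((‖a i‖ : ℂ) / a i) * ((a i - z) / (1 - (starRingEnd ℂ) (a i) * z))

/-- `f` is a Blaschke product on the set `s`: it agrees there with
`c z^m ∏ᵢ (|aᵢ|/aᵢ)(aᵢ - z)/(1 - conj aᵢ z)` where `|c| = 1`, the `aᵢ` form a (finite or
countable) family of nonzero points of the open unit disc satisfying the Blaschke condition
`∑ᵢ (1 - |aᵢ|) < ∞`. -/
def IsBlaschkeProductOn (f : ℂ → ℂ) (s : Set ℂ) : Prop :=
  ∃ (m : ℕ) (c : ℂ) (ι : Type) (_ : Countable ι) (a : ι → ℂ),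
    ‖c‖ = 1 ∧ (∀ i, a i ≠ 0 ∧ ‖a i‖ < 1) ∧
    Summable (fun i => 1 - ‖a i‖) ∧
    Set.EqOn f (blaschkeProd m c a) s

/-- `φ` is an inner function: a bounded holomorphic function on the open unit disc whose radial
boundary values have modulus one almost everywhere. -/
def IsInner (φ : ℂ → ℂ) : Prop :=
  DifferentiableOn ℂ φ (ball (0:ℂ) 1) ∧
  (∃ C : ℝ, ∀ z ∈ ball (0:ℂ) 1, ‖φ z‖ ≤ C) ∧
  ∀ᵐ (θ : ℝ) ∂(volume.restrict (Set.Ioc (0:ℝ) (2*π))),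
    ∃ L : ℂ, ‖L‖ = 1 ∧
      Tendsto (fun r : ℝ => φ ((r : ℂ) * Complex.exp ((θ : ℂ) * Complex.I)))
        (𝓝[<] (1:ℝ)) (𝓝 L)

/-- The Cauchy kernel is dominated by a geometric superposition of normalized indicators. -/
lemma cauchy_kernel_le_tsum {δ : ℝ} (hδ : 0 < δ) (θ t : ℝ) :
    ENNReal.ofReal (δ / (δ ^ 2 + (t - θ) ^ 2)) ≤
      ∑' k : ℕ, (closedBall θ (2 ^ k * δ)).indicator
        (fun _ => ENNReal.ofReal (8 / 2 ^ k * (2 * (2 ^ k * δ))⁻¹)) t := by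
  obtain ⟨k, hk, hk'⟩ : ∃ k : ℕ, |t - θ| ≤ 2 ^ k * δ ∧ (4:ℝ) ^ k * δ ^ 2 ≤
      4 * (δ ^ 2 + (t - θ) ^ 2) := by
    classical
    have hex : ∃ k : ℕ, |t - θ| ≤ 2 ^ k * δ := by
      obtain ⟨k, hk⟩ := pow_unbounded_of_one_lt (|t - θ| / δ) (one_lt_two (α := ℝ))
      exact ⟨k, ((div_lt_iff₀ hδ).1 hk).le⟩
    refine ⟨Nat.find hex, Nat.find_spec hex, ?_⟩
    rcases hf : Nat.find hex with _ | j
    · nlinarith [sq_nonneg (t - θ), sq_nonneg δ]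
    · have hj : ¬ |t - θ| ≤ 2 ^ j * δ := Nat.find_min hex (by omega)
      have h1 : (2 ^ j * δ) ^ 2 ≤ |t - θ| ^ 2 := by
        have := (not_le.1 hj).le
        gcongr
      rw [sq_abs, mul_pow, ← pow_mul, mul_comm j, pow_mul] at h1
      norm_num at h1
      rw [pow_succ]
      nlinarith [sq_nonneg δ]
  refine le_trans ?_ (ENNReal.le_tsum k)
  rw [indicator_of_mem (by simpa [Real.dist_eq] using hk)]
  apply ENNReal.ofReal_le_ofReal
  have h4 : (4:ℝ) ^ k = 2 ^ k * 2 ^ k := by rw [← mul_pow]; norm_num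
  have h2 : (0:ℝ) < 2 ^ k := by positivity
  rw [h4] at hk'
  rw [← div_eq_mul_inv, div_div, div_le_div_iff₀ (by positivity) (by positivity)]
  nlinarith

/-- The mean oscillation of `f` around `θ` with respect to the Cauchy kernel of width `δ`. -/
noncomputable def cauchyOsc (f : ℝ → ℂ) (δ θ : ℝ) : ENNReal :=
  ∫⁻ t, ENNReal.ofReal (δ / (δ ^ 2 + (t - θ) ^ 2)) * ‖f t - f θ‖ₑ

lemma locallyIntegrable_of_bounded {f : ℝ → ℂ} (hf : Measurable f) {M : ℝ} (hM : ∀ t, ‖f t‖ ≤ M) :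
    LocallyIntegrable f :=
  (locallyIntegrable_const M).mono hf.aestronglyMeasurable
    (Eventually.of_forall fun t => (hM t).trans (le_abs_self M))

lemma cauchyOsc_le_tsum {f : ℝ → ℂ} (hf : Measurable f) {M : ℝ} (hM : ∀ t, ‖f t‖ ≤ M)
    {δ : ℝ} (hδ : 0 < δ) (θ : ℝ) :
    cauchyOsc f δ θ ≤
      ∑' k : ℕ, ENNReal.ofReal (8 / 2 ^ k * ⨍ t in closedBall θ (2 ^ k * δ), ‖f t - f θ‖) := by
  have hmeas : ∀ k : ℕ, Measurable fun t => (closedBall θ (2 ^ k * δ)).indicator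
      (fun _ => ENNReal.ofReal (8 / 2 ^ k * (2 * (2 ^ k * δ))⁻¹)) t := fun k =>
    measurable_const.indicator measurableSet_closedBall
  calc cauchyOsc f δ θ
      ≤ ∫⁻ t, (∑' k : ℕ, (closedBall θ (2 ^ k * δ)).indicator
        (fun _ => ENNReal.ofReal (8 / 2 ^ k * (2 * (2 ^ k * δ))⁻¹)) t) * ‖f t - f θ‖ₑ := by
        apply lintegral_mono
        exact fun t => mul_le_mul' (cauchy_kernel_le_tsum hδ θ t) le_rfl
    _ = ∑' k : ℕ, ∫⁻ t, (closedBall θ (2 ^ k * δ)).indicator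
        (fun _ => ENNReal.ofReal (8 / 2 ^ k * (2 * (2 ^ k * δ))⁻¹)) t * ‖f t - f θ‖ₑ := by
        simp_rw [← ENNReal.tsum_mul_right]
        rw [lintegral_tsum]
        intro k
        exact ((hmeas k).mul (by fun_prop)).aemeasurable
    _ = _ := by
        refine tsum_congr fun k => ?_
        have h1 : ∀ t, (closedBall θ (2 ^ k * δ)).indicator
            (fun _ => ENNReal.ofReal (8 / 2 ^ k * (2 * (2 ^ k * δ))⁻¹)) t * ‖f t - f θ‖ₑ =
            (closedBall θ (2 ^ k * δ)).indicator
            (fun t => ENNReal.ofReal (8 / 2 ^ k * (2 * (2 ^ k * δ))⁻¹) * ‖f t - f θ‖ₑ) t := by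
          intro t
          by_cases ht : t ∈ closedBall θ (2 ^ k * δ) <;> simp [ht]
        simp_rw [h1]
        rw [lintegral_indicator measurableSet_closedBall, lintegral_const_mul _ (by fun_prop)]
        have hint : IntegrableOn (fun t => f t - f θ) (closedBall θ (2 ^ k * δ)) :=
          ((locallyIntegrable_of_bounded hf hM).sub
            (locallyIntegrable_const _)).integrableOn_isCompact (isCompact_closedBall _ _)
        rw [setAverage_eq, Measure.real, Real.volume_closedBall,
          ENNReal.toReal_ofReal (by positivity), smul_eq_mul,
          ← ofReal_integral_norm_eq_lintegral_enorm hint, ← ENNReal.ofReal_mul (by positivity),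
          mul_assoc]

lemma summable_eight_div (M : ℝ) : Summable fun k : ℕ => 8 / 2 ^ k * M := by
  refine Summable.mul_right _ ?_
  simpa [div_eq_mul_inv] using (summable_geometric_two.mul_left (8:ℝ))

lemma average_norm_sub_le {f : ℝ → ℂ} (hf : Measurable f) {M : ℝ} (hM : ∀ t, ‖f t‖ ≤ M)
    {r : ℝ} (hr : 0 < r) (θ : ℝ) :
    ⨍ t in closedBall θ r, ‖f t - f θ‖ ≤ 2 * M := by
  have hint : IntegrableOn (fun t => f t - f θ) (closedBall θ r) :=
    ((locallyIntegrable_of_bounded hf hM).sub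
      (locallyIntegrable_const _)).integrableOn_isCompact (isCompact_closedBall _ _)
  have h2 : ∀ t, ‖f t - f θ‖ ≤ 2 * M := fun t => by
    linarith [norm_sub_le (f t) (f θ), hM t, hM θ]
  have := setIntegral_mono (μ := volume) (s := closedBall θ r) hint.norm
    (integrableOn_const measure_closedBall_lt_top.ne) h2
  rw [setIntegral_const, smul_eq_mul] at this
  have hv : 0 < volume.real (closedBall θ r) := by
    rw [Measure.real, Real.volume_closedBall, ENNReal.toReal_ofReal (by positivity)]; positivity
  rw [setAverage_eq, smul_eq_mul, inv_mul_le_iff₀ hv]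
  exact this

lemma average_norm_sub_nonneg (f : ℝ → ℂ) (r θ : ℝ) :
    0 ≤ ⨍ t in closedBall θ r, ‖f t - f θ‖ := by
  rw [setAverage_eq]
  positivity

lemma cauchyOsc_le {f : ℝ → ℂ} (hf : Measurable f) {M : ℝ} (hM : ∀ t, ‖f t‖ ≤ M)
    {δ : ℝ} (hδ : 0 < δ) (θ : ℝ) :
    cauchyOsc f δ θ ≤ ENNReal.ofReal (∑' k : ℕ, 8 / 2 ^ k * (2 * M)) := by
  refine (cauchyOsc_le_tsum hf hM hδ θ).trans ?_
  have hM0 : 0 ≤ M := (norm_nonneg _).trans (hM 0)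
  rw [ENNReal.ofReal_tsum_of_nonneg (fun k => by positivity) (summable_eight_div _)]
  refine ENNReal.tsum_le_tsum fun k => ENNReal.ofReal_le_ofReal ?_
  gcongr
  exact average_norm_sub_le hf hM (by positivity) θ

/-- The mean oscillation tends to zero at almost every point. -/
lemma ae_tendsto_cauchyOsc {f : ℝ → ℂ} (hf : Measurable f) {M : ℝ} (hM : ∀ t, ‖f t‖ ≤ M) :
    ∀ᵐ θ, Tendsto (fun δ => cauchyOsc f δ θ) (𝓝[>] 0) (𝓝 0) := by
  have hM0 : 0 ≤ M := (norm_nonneg _).trans (hM 0)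
  filter_upwards [IsUnifLocDoublingMeasure.ae_tendsto_average_norm_sub volume
    (locallyIntegrable_of_bounded hf hM) 1] with θ hθ
  have key : Tendsto (fun δ : ℝ => ∑' k : ℕ,
      8 / 2 ^ k * ⨍ t in closedBall θ (2 ^ k * δ), ‖f t - f θ‖) (𝓝[>] 0)
      (𝓝 (∑' k : ℕ, 8 / 2 ^ k * 0)) := by
    refine tendsto_tsum_of_dominated_convergence (summable_eight_div (2 * M)) ?_ ?_
    · intro k
      have hlim : Tendsto (fun δ : ℝ => 2 ^ k * δ) (𝓝[>] 0) (𝓝[>] 0) := by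
        refine tendsto_nhdsWithin_iff.2 ⟨?_, ?_⟩
        · have : Tendsto (fun δ : ℝ => 2 ^ k * δ) (𝓝 0) (𝓝 (2 ^ k * 0)) :=
            tendsto_id.const_mul _
          rw [mul_zero] at this
          exact this.mono_left nhdsWithin_le_nhds
        · filter_upwards [self_mem_nhdsWithin] with δ hδ
          have : (0:ℝ) < δ := hδ
          exact mem_Ioi.2 (by positivity)
      refine Tendsto.const_mul _ (hθ (fun _ => θ) (fun δ => 2 ^ k * δ) hlim ?_)
      filter_upwards [self_mem_nhdsWithin] with δ hδ
      have : (0:ℝ) < δ := hδ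
      simp only [mem_closedBall, dist_self]
      positivity
    · filter_upwards [self_mem_nhdsWithin] with δ hδ k
      have : (0:ℝ) < δ := hδ
      rw [Real.norm_of_nonneg (mul_nonneg (by positivity) (average_norm_sub_nonneg _ _ _))]
      gcongr
      exact average_norm_sub_le hf hM (by positivity) θ
  simp only [mul_zero, tsum_zero] at key
  have key2 := ENNReal.tendsto_ofReal key
  rw [ENNReal.ofReal_zero] at key2
  refine tendsto_of_tendsto_of_tendsto_of_le_of_le' tendsto_const_nhds key2
    (Eventually.of_forall fun _ => zero_le) ?_
  filter_upwards [self_mem_nhdsWithin] with δ hδ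
  have hδ : (0:ℝ) < δ := hδ
  refine (cauchyOsc_le_tsum hf hM hδ θ).trans ?_
  have hnn : ∀ k : ℕ, 0 ≤ 8 / 2 ^ k * ⨍ t in closedBall θ (2 ^ k * δ), ‖f t - f θ‖ := fun k =>
    mul_nonneg (by positivity) (average_norm_sub_nonneg _ _ _)
  rw [ENNReal.ofReal_tsum_of_nonneg hnn]
  refine Summable.of_nonneg_of_le hnn (fun k => ?_) (summable_eight_div (2 * M))
  gcongr
  exact average_norm_sub_le hf hM (by positivity) θ

/-- A single normalized Blaschke factor. -/
noncomputable def blaschkeFactor (a z : ℂ) : ℂ :=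
  ((‖a‖ : ℂ) / a) * ((a - z) / (1 - (starRingEnd ℂ) a * z))

lemma one_sub_conj_mul_ne_zero {a z : ℂ} (ha : ‖a‖ < 1) (hz : ‖z‖ ≤ 1) :
    1 - (starRingEnd ℂ) a * z ≠ 0 := by
  intro h
  have h1 : ‖(starRingEnd ℂ) a * z‖ = 1 := by rw [← sub_eq_zero.1 h, norm_one]
  rw [norm_mul, Complex.norm_conj] at h1
  nlinarith [norm_nonneg a, norm_nonneg z]

lemma normSq_one_sub_conj_mul_sub (a z : ℂ) :
    normSq (1 - (starRingEnd ℂ) a * z) - normSq (a - z) = (1 - normSq a) * (1 - normSq z) := by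
  simp only [normSq_apply, sub_re, sub_im, mul_re, mul_im, conj_re, conj_im, one_re, one_im]
  ring

lemma norm_blaschkeFactor {a : ℂ} (ha : a ≠ 0) (z : ℂ) :
    ‖blaschkeFactor a z‖ = ‖a - z‖ / ‖1 - (starRingEnd ℂ) a * z‖ := by
  rw [blaschkeFactor, norm_mul, norm_div, norm_div, norm_real, norm_norm,
    div_self (norm_ne_zero_iff.2 ha), one_mul]

lemma norm_blaschkeFactor_le_one {a z : ℂ} (ha : a ≠ 0) (ha' : ‖a‖ < 1) (hz : ‖z‖ ≤ 1) :
    ‖blaschkeFactor a z‖ ≤ 1 := by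
  rw [norm_blaschkeFactor ha, div_le_one (norm_pos_iff.2 (one_sub_conj_mul_ne_zero ha' hz))]
  have h := normSq_one_sub_conj_mul_sub a z
  simp only [normSq_eq_norm_sq] at h
  have h2 : 0 ≤ (1 - ‖a‖ ^ 2) * (1 - ‖z‖ ^ 2) :=
    mul_nonneg (by nlinarith [norm_nonneg a]) (by nlinarith [norm_nonneg z])
  exact abs_le_of_sq_le_sq' (by linarith) (norm_nonneg _) |>.2

lemma norm_blaschkeFactor_eq_one {a z : ℂ} (ha : a ≠ 0) (ha' : ‖a‖ < 1) (hz : ‖z‖ = 1) :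
    ‖blaschkeFactor a z‖ = 1 := by
  have hne := one_sub_conj_mul_ne_zero ha' hz.le
  rw [norm_blaschkeFactor ha, div_eq_one_iff_eq (norm_ne_zero_iff.2 hne)]
  have h := normSq_one_sub_conj_mul_sub a z
  simp only [normSq_eq_norm_sq, hz] at h
  exact (sq_eq_sq₀ (norm_nonneg _) (norm_nonneg _)).1 (by linarith)

lemma blaschkeFactor_zero {a : ℂ} (ha : a ≠ 0) : blaschkeFactor a 0 = ‖a‖ := by
  simp [blaschkeFactor, ha]

lemma norm_blaschkeFactor_sub_one_le {a z : ℂ} (ha : a ≠ 0) (ha' : ‖a‖ < 1) {R : ℝ}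
    (hR : R < 1) (hz : ‖z‖ ≤ R) :
    ‖blaschkeFactor a z - 1‖ ≤ (1 - ‖a‖) * (2 / (1 - R)) := by
  have hne := one_sub_conj_mul_ne_zero ha' (hz.trans hR.le)
  have hsq : a * (starRingEnd ℂ) a = (‖a‖ : ℂ) ^ 2 := by
    rw [mul_conj, normSq_eq_norm_sq]; push_cast; ring
  have h1 : blaschkeFactor a z - 1 =
      -((1 - (‖a‖ : ℂ)) * (a + ‖a‖ * z) / (a * (1 - (starRingEnd ℂ) a * z))) := by
    have hne' : 1 - z * (starRingEnd ℂ) a ≠ 0 := by rwa [mul_comm]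
    rw [blaschkeFactor]
    field_simp
    linear_combination z * hsq
  have h2 : ‖a + ‖a‖ * z‖ ≤ ‖a‖ * 2 := by
    refine (norm_add_le _ _).trans ?_
    rw [norm_mul, norm_real, norm_norm]
    nlinarith [norm_nonneg a]
  have h3 : 1 - R ≤ ‖1 - (starRingEnd ℂ) a * z‖ := by
    have := norm_sub_norm_le (1:ℂ) ((starRingEnd ℂ) a * z)
    rw [norm_mul, norm_conj, norm_one] at this
    nlinarith [norm_nonneg a, norm_nonneg z]
  have h4 : ‖1 - (‖a‖ : ℂ)‖ = 1 - ‖a‖ := by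
    rw [← ofReal_one, ← ofReal_sub, norm_real, Real.norm_of_nonneg (by linarith)]
  have ha0 : 0 < ‖a‖ := norm_pos_iff.2 ha
  have hR' : 0 < 1 - R := by linarith
  have h5 : 0 ≤ 1 - ‖a‖ := by linarith
  rw [h1, norm_neg, norm_div, norm_mul, norm_mul, h4, div_le_iff₀ (by nlinarith)]
  calc (1 - ‖a‖) * ‖a + ‖a‖ * z‖ ≤ (1 - ‖a‖) * (‖a‖ * 2) := by gcongr
    _ = (1 - ‖a‖) * (2 / (1 - R)) * (‖a‖ * (1 - R)) := by field_simp
    _ ≤ _ := by gcongr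

lemma differentiableAt_blaschkeFactor {a z : ℂ} (ha : ‖a‖ < 1) (hz : ‖z‖ ≤ 1) :
    DifferentiableAt ℂ (blaschkeFactor a) z := by
  unfold blaschkeFactor
  have := one_sub_conj_mul_ne_zero ha hz
  fun_prop (disch := assumption)

/-- A finite Blaschke product with zeros `a k`, `k ∈ S`. -/
noncomputable def finBlaschke (S : Finset ℕ) (a : ℕ → ℂ) (z : ℂ) : ℂ :=
  ∏ k ∈ S, blaschkeFactor (a k) z

section FinBlaschke
variable {S : Finset ℕ} {a : ℕ → ℂ}

lemma norm_finBlaschke_eq_one (ha : ∀ k, a k ≠ 0 ∧ ‖a k‖ < 1) {z : ℂ} (hz : ‖z‖ = 1) :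
    ‖finBlaschke S a z‖ = 1 := by
  rw [finBlaschke, norm_prod]
  exact Finset.prod_eq_one fun k _ => norm_blaschkeFactor_eq_one (ha k).1 (ha k).2 hz

lemma norm_finBlaschke_le_one (ha : ∀ k, a k ≠ 0 ∧ ‖a k‖ < 1) {z : ℂ} (hz : ‖z‖ ≤ 1) :
    ‖finBlaschke S a z‖ ≤ 1 := by
  rw [finBlaschke, norm_prod]
  exact Finset.prod_le_one (fun _ _ => norm_nonneg _)
    fun k _ => norm_blaschkeFactor_le_one (ha k).1 (ha k).2 hz

lemma differentiableAt_finBlaschke (ha : ∀ k, a k ≠ 0 ∧ ‖a k‖ < 1) {z : ℂ} (hz : ‖z‖ ≤ 1) :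
    DifferentiableAt ℂ (finBlaschke S a) z := by
  unfold finBlaschke
  exact DifferentiableAt.fun_finsetProd fun k _ => differentiableAt_blaschkeFactor (ha k).2 hz

lemma one_sub_sum_le_finBlaschke_zero (ha : ∀ k, a k ≠ 0 ∧ ‖a k‖ < 1) :
    1 - ∑ k ∈ S, (1 - ‖a k‖) ≤ (finBlaschke S a 0).re := by
  have h : finBlaschke S a 0 = ((∏ k ∈ S, ‖a k‖ : ℝ) : ℂ) := by
    rw [finBlaschke, ofReal_prod]
    exact Finset.prod_congr rfl fun k _ => blaschkeFactor_zero (ha k).1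
  rw [h, ofReal_re]
  clear h
  induction S using Finset.induction_on with
  | empty => simp
  | insert x t hx ih =>
    rw [Finset.prod_insert hx, Finset.sum_insert hx]
    have h1 : ∏ k ∈ t, ‖a k‖ ≤ 1 :=
      Finset.prod_le_one (fun _ _ => norm_nonneg _) fun k _ => (ha k).2.le
    nlinarith [(ha x).2, norm_nonneg (a x)]

end FinBlaschke

/-- The Poisson kernel of the unit disc, as a function of the radius and the angle. -/
noncomputable def diskPoisson (r x : ℝ) : ℝ := (1 - r ^ 2) / ‖1 - r * cexp (x * I)‖ ^ 2

lemma one_sub_le_norm_one_sub_mul_exp {r : ℝ} (hr : 0 ≤ r) (x : ℝ) :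
    1 - r ≤ ‖1 - r * cexp (x * I)‖ := by
  have := norm_sub_norm_le (1:ℂ) (r * cexp (x * I))
  rwa [norm_mul, norm_exp_ofReal_mul_I, norm_one, norm_real, Real.norm_of_nonneg hr, mul_one] at this

lemma diskPoisson_nonneg {r : ℝ} (hr : 0 ≤ r) (hr1 : r < 1) (x : ℝ) : 0 ≤ diskPoisson r x :=
  div_nonneg (by nlinarith) (by positivity)

lemma normSq_one_sub_mul_exp (r x : ℝ) :
    ‖1 - r * cexp (x * I)‖ ^ 2 = (1 - r) ^ 2 + 2 * r * (1 - Real.cos x) := by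
  rw [← normSq_eq_norm_sq, normSq_apply]
  simp only [sub_re, sub_im, one_re, one_im, re_ofReal_mul, im_ofReal_mul, exp_ofReal_mul_I_re,
    exp_ofReal_mul_I_im]
  linear_combination r ^ 2 * Real.sin_sq_add_cos_sq x

lemma diskPoisson_le_cauchy {r x : ℝ} (hr : 1 / 2 ≤ r) (hr1 : r < 1) (hx : |x| ≤ π) :
    diskPoisson r x ≤ 16 * ((1 - r) / ((1 - r) ^ 2 + x ^ 2)) := by
  have h1 : 0 < 1 - r := by linarith
  have hc := Real.cos_le_one_sub_mul_cos_sq hx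
  have h2 : ((1 - r) ^ 2 + x ^ 2) / 8 ≤ ‖1 - r * cexp (x * I)‖ ^ 2 := by
    rw [normSq_one_sub_mul_exp]
    have h3 : x ^ 2 / 8 ≤ 1 - Real.cos x := by
      have h4 : x ^ 2 / 8 ≤ 2 / π ^ 2 * x ^ 2 := by
        rw [div_eq_mul_inv, mul_comm]
        gcongr
        rw [le_div_iff₀ (by positivity)]
        nlinarith [Real.pi_lt_four, Real.pi_pos]
      linarith
    nlinarith [sq_nonneg x, sq_nonneg (1 - r)]
  unfold diskPoisson
  have h5 : 0 < (1 - r) ^ 2 + x ^ 2 := by positivity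
  calc (1 - r ^ 2) / ‖1 - r * cexp (x * I)‖ ^ 2
      ≤ (2 * (1 - r)) / (((1 - r) ^ 2 + x ^ 2) / 8) := by
        gcongr
        nlinarith
    _ = _ := by field_simp; norm_num

lemma continuous_diskPoisson {r : ℝ} (hr : 0 ≤ r) (hr1 : r < 1) : Continuous (diskPoisson r) := by
  unfold diskPoisson
  refine Continuous.div (by fun_prop) (by fun_prop) fun x => ?_
  have := one_sub_le_norm_one_sub_mul_exp hr x
  have : 0 < ‖1 - r * cexp (x * I)‖ := by linarith
  positivity

/-- **Poisson formula** on a window centred at the argument of the evaluation point. -/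
lemma poisson_formula {f : ℂ → ℂ} (hf : DiffContOnCl ℂ f (ball 0 1)) {r : ℝ} (hr : 0 ≤ r)
    (hr1 : r < 1) (θ : ℝ) :
    f (r * cexp (θ * I)) =
      (2 * π)⁻¹ • ∫ t in (θ - π)..(θ + π), diskPoisson r (t - θ) • f (cexp (t * I)) := by
  have hw : (r * cexp (θ * I)) ∈ ball (0:ℂ) 1 := by
    simpa [norm_exp_ofReal_mul_I, abs_of_nonneg hr] using hr1
  rw [← hf.circleAverage_poissonKernel_smul hw, Real.circleAverage_eq_integral_add (θ - π)]
  congr 1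
  have := intervalIntegral.integral_comp_add_right (a := 0) (b := 2 * π)
    (fun t => (poissonKernel 0 (r * cexp (θ * I)) • f) (circleMap 0 1 t)) (θ - π)
  rw [this, show 0 + (θ - π) = θ - π by ring, show 2 * π + (θ - π) = θ + π by ring]
  refine intervalIntegral.integral_congr fun t _ => ?_
  have h1 : circleMap 0 1 t = cexp (t * I) := by simp [circleMap]
  simp only [Pi.smul_apply', h1]
  congr 1
  have h2 : ‖cexp (t * I) - r * cexp (θ * I)‖ = ‖1 - r * cexp (((t - θ : ℝ) : ℂ) * I)‖ := by
    have : cexp (t * I) - r * cexp (θ * I) =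
        cexp (t * I) * (starRingEnd ℂ) (1 - r * cexp (((t - θ : ℝ) : ℂ) * I)) := by
      simp only [map_sub, map_one, map_mul, conj_ofReal, ← exp_conj, conj_I]
      rw [mul_sub, mul_one, mul_left_comm, ← Complex.exp_add]
      congr 3
      push_cast; ring
    rw [this, norm_mul, norm_exp_ofReal_mul_I, one_mul, norm_conj]
  simp only [poissonKernel_def, sub_zero, h2, diskPoisson, norm_mul, norm_exp_ofReal_mul_I,
    norm_real, Real.norm_of_nonneg hr, mul_one, one_pow]

lemma integral_diskPoisson {r : ℝ} (hr : 0 ≤ r) (hr1 : r < 1) (θ : ℝ) :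
    (2 * π)⁻¹ * ∫ t in (θ - π)..(θ + π), diskPoisson r (t - θ) = 1 := by
  have h := poisson_formula (f := fun _ => 1) (diffContOnCl_const) hr hr1 θ
  have h2 := congrArg Complex.re h
  simpa [intervalIntegral.integral_ofReal] using h2.symm

lemma periodic_exp_ofReal_mul_I : Function.Periodic (fun θ : ℝ => cexp (θ * I)) (2 * π) := fun θ => by
  simpa using Complex.exp_mul_I_periodic (θ : ℂ)

lemma ae_of_periodic {p : ℝ → Prop} (hp : ∀ θ, p (θ + 2 * π) ↔ p θ)
    (h : ∀ᵐ θ ∂(volume.restrict (Ioc (0:ℝ) (2 * π))), p θ) : ∀ᵐ θ, p θ := by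
  have hF := isAddFundamentalDomain_Ioc Real.two_pi_pos (0:ℝ)
  rw [zero_add] at hF
  refine hF.measure_zero_of_invariant {θ | ¬ p θ} (fun g => ?_) ?_
  · obtain ⟨g, hg⟩ := g
    obtain ⟨n, rfl⟩ := AddSubgroup.mem_zmultiples_iff.1 hg
    have hper : Function.Periodic p (2 * π) := fun θ => propext (hp θ)
    ext θ
    rw [mem_vadd_set_iff_neg_vadd_mem]
    have h3 := (hper.zsmul n).sub_eq θ
    simp only [mem_ofPred_eq]
    rw [← h3]
    have : (-(⟨n • (2 * π), hg⟩ : AddSubgroup.zmultiples (2 * π)) +ᵥ θ) = θ - n • (2 * π) := by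
      rw [AddSubgroup.vadd_def, vadd_eq_add]; simp; ring
    rw [this]
  · rw [ae_iff, Measure.restrict_apply₀' measurableSet_Ioc.nullMeasurableSet] at h
    exact h

section FinBlaschke
variable {S : Finset ℕ} {a : ℕ → ℂ}

lemma diffContOnCl_finBlaschke (ha : ∀ k, a k ≠ 0 ∧ ‖a k‖ < 1) :
    DiffContOnCl ℂ (finBlaschke S a) (ball 0 1) := by
  refine DifferentiableOn.diffContOnCl fun z hz => ?_
  rw [closure_ball _ one_ne_zero, mem_closedBall, dist_zero_right] at hz
  exact (differentiableAt_finBlaschke ha hz).differentiableWithinAt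

lemma continuous_finBlaschke_exp (ha : ∀ k, a k ≠ 0 ∧ ‖a k‖ < 1) :
    Continuous fun θ : ℝ => finBlaschke S a (cexp (θ * I)) := by
  refine continuous_iff_continuousAt.2 fun θ => ?_
  have := (differentiableAt_finBlaschke (S := S) ha
    (norm_exp_ofReal_mul_I θ).le).continuousAt
  exact ContinuousAt.comp (f := fun θ : ℝ => cexp (θ * I)) this (by fun_prop)

lemma lintegral_finBlaschke_sub_one_le (ha : ∀ k, a k ≠ 0 ∧ ‖a k‖ < 1) {c : ℝ} (hc : 0 < c) :
    ∫⁻ θ in Ioc (0:ℝ) (2 * π), ‖finBlaschke S a (cexp (θ * I)) - 1‖ₑ ≤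
      ENNReal.ofReal (π * c + 2 * π * (∑ k ∈ S, (1 - ‖a k‖)) / c) := by
  have hcont := continuous_finBlaschke_exp (S := S) ha
  have hcre : Continuous fun θ : ℝ => (finBlaschke S a (cexp (θ * I))).re :=
    continuous_re.comp hcont
  have hmv : ∫ θ in (0:ℝ)..(2 * π), (finBlaschke S a (cexp (θ * I))).re =
      2 * π * (finBlaschke S a 0).re := by
    have h := (diffContOnCl_finBlaschke (S := S) ha)
    rw [← abs_one (α := ℝ)] at h
    have h2 := h.circleAverage
    rw [Real.circleAverage_def] at h2
    have h3 := congrArg Complex.re h2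
    rw [real_smul, re_ofReal_mul] at h3
    simp only [circleMap, ofReal_one, one_mul, zero_add] at h3
    rw [← h3]
    have h4 := intervalIntegral.intervalIntegral_re (𝕜 := ℂ) (hcont.intervalIntegrable (μ := volume) 0 (2 * π))
    simp only [RCLike.re_to_complex] at h4
    rw [h4, mul_inv_cancel_left₀ Real.two_pi_pos.ne']
  have hpt : ∀ θ : ℝ, ‖finBlaschke S a (cexp (θ * I)) - 1‖ ≤
      c / 2 + (1 - (finBlaschke S a (cexp (θ * I))).re) / c := by
    intro θ
    have h1 := norm_finBlaschke_eq_one (S := S) ha (norm_exp_ofReal_mul_I θ)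
    set w := finBlaschke S a (cexp (θ * I))
    have h2 : ‖w - 1‖ ^ 2 = 2 * (1 - w.re) := by
      have h3 : ‖w‖ ^ 2 = 1 := by rw [h1]; norm_num
      rw [← normSq_eq_norm_sq, normSq_apply] at h3 ⊢
      simp only [sub_re, sub_im, one_re, one_im]
      linarith
    have h4 : 1 - w.re = ‖w - 1‖ ^ 2 / 2 := by linarith
    rw [h4, ← sub_nonneg]
    have : c / 2 + ‖w - 1‖ ^ 2 / 2 / c - ‖w - 1‖ = (c - ‖w - 1‖) ^ 2 / (2 * c) := by
      field_simp; ring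
    rw [this]
    positivity
  have hint : IntegrableOn (fun θ : ℝ => c / 2 + (1 - (finBlaschke S a (cexp (θ * I))).re) / c)
      (Ioc 0 (2 * π)) :=
    (Continuous.integrableOn_Icc (by fun_prop)).mono_set Ioc_subset_Icc_self
  calc ∫⁻ θ in Ioc (0:ℝ) (2 * π), ‖finBlaschke S a (cexp (θ * I)) - 1‖ₑ
      ≤ ∫⁻ θ in Ioc (0:ℝ) (2 * π),
          ENNReal.ofReal (c / 2 + (1 - (finBlaschke S a (cexp (θ * I))).re) / c) := by
        refine lintegral_mono fun θ => ?_
        rw [← ofReal_norm]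
        exact ENNReal.ofReal_le_ofReal (hpt θ)
    _ = ENNReal.ofReal (∫ θ in (0:ℝ)..(2 * π),
          (c / 2 + (1 - (finBlaschke S a (cexp (θ * I))).re) / c)) := by
        rw [intervalIntegral.integral_of_le Real.two_pi_pos.le,
          ofReal_integral_eq_lintegral_ofReal hint
            (Eventually.of_forall fun θ => (norm_nonneg _).trans (hpt θ))]
    _ ≤ _ := by
        apply ENNReal.ofReal_le_ofReal
        rw [intervalIntegral.integral_add (by simp) (Continuous.intervalIntegrable (by fun_prop) _ _),
          intervalIntegral.integral_const, intervalIntegral.integral_div,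
          intervalIntegral.integral_sub (by simp)
          (hcre.intervalIntegrable _ _), hmv]
        simp only [intervalIntegral.integral_const, sub_zero, smul_eq_mul, mul_one]
        have h0 := one_sub_sum_le_finBlaschke_zero (S := S) ha
        have h5 : 2 * π - 2 * π * (finBlaschke S a 0).re ≤ 2 * π * ∑ k ∈ S, (1 - ‖a k‖) := by
          nlinarith [Real.pi_pos]
        have : 2 * π * (c / 2) = π * c := by ring
        rw [this]
        gcongr

end FinBlaschke

/-- The finite Blaschke product collecting the zeros of the first `n` stages. -/
noncomputable def stageProd (S : ℕ → Finset ℕ) (a : ℕ → ℕ → ℂ) (n : ℕ) (z : ℂ) : ℂ :=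
  ∏ m ∈ Finset.range n, finBlaschke (S m) (a m) z

/-- The infinite Blaschke product collecting the zeros of all stages. -/
noncomputable def stagedBlaschke (S : ℕ → Finset ℕ) (a : ℕ → ℕ → ℂ) : ℂ → ℂ :=
  blaschkeProd 0 1 (fun i : Σ n, S n => a i.1 i.2)

section Staged
variable {S : ℕ → Finset ℕ} {a : ℕ → ℕ → ℂ} {K : ℝ}

lemma stagedBlaschke_eq_tprod (z : ℂ) :
    stagedBlaschke S a z = ∏' i : Σ n, S n, blaschkeFactor (a i.1 i.2) z := by
  simp [stagedBlaschke, blaschkeProd, blaschkeFactor]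

lemma norm_stageProd_eq_one (ha : ∀ n k, a n k ≠ 0 ∧ ‖a n k‖ < 1) (n : ℕ) {z : ℂ} (hz : ‖z‖ = 1) :
    ‖stageProd S a n z‖ = 1 := by
  rw [stageProd, norm_prod]
  exact Finset.prod_eq_one fun m _ => norm_finBlaschke_eq_one (ha m) hz

lemma norm_stageProd_le_one (ha : ∀ n k, a n k ≠ 0 ∧ ‖a n k‖ < 1) (n : ℕ) {z : ℂ} (hz : ‖z‖ ≤ 1) :
    ‖stageProd S a n z‖ ≤ 1 := by
  rw [stageProd, norm_prod]
  exact Finset.prod_le_one (fun _ _ => norm_nonneg _)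
    fun m _ => norm_finBlaschke_le_one (ha m) hz

lemma diffContOnCl_stageProd (ha : ∀ n k, a n k ≠ 0 ∧ ‖a n k‖ < 1) (n : ℕ) :
    DiffContOnCl ℂ (stageProd S a n) (ball 0 1) := by
  refine DifferentiableOn.diffContOnCl fun z hz => ?_
  rw [closure_ball _ one_ne_zero, mem_closedBall, dist_zero_right] at hz
  unfold stageProd
  exact (DifferentiableAt.fun_finsetProd fun m _ =>
    differentiableAt_finBlaschke (ha m) hz).differentiableWithinAt

lemma continuous_stageProd_exp (ha : ∀ n k, a n k ≠ 0 ∧ ‖a n k‖ < 1) (n : ℕ) :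
    Continuous fun θ : ℝ => stageProd S a n (cexp (θ * I)) := by
  unfold stageProd
  exact continuous_finsetProd _ fun m _ => continuous_finBlaschke_exp (ha m)

lemma summable_one_sub_norm (ha : ∀ n k, a n k ≠ 0 ∧ ‖a n k‖ < 1)
    (hK : ∀ n, ∑ k ∈ S n, (1 - ‖a n k‖) ≤ K * (1 / 4) ^ n) :
    Summable fun i : Σ n, S n => 1 - ‖a i.1 i.2‖ := by
  refine (summable_sigma_of_nonneg fun i => by linarith [(ha i.1 i.2).2]).2
    ⟨fun n => Summable.of_finite, ?_⟩
  refine Summable.of_nonneg_of_le (fun n => tsum_nonneg fun k => by linarith [(ha n k).2])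
    (fun n => ?_) ((summable_geometric_of_lt_one (r := (1 / 4 : ℝ)) (by norm_num)
      (by norm_num)).mul_left K)
  rw [tsum_fintype]
  exact (Finset.sum_coe_sort (S n) fun k => 1 - ‖a n k‖).trans_le (hK n)

lemma hasProdLocallyUniformlyOn_stagedBlaschke (ha : ∀ n k, a n k ≠ 0 ∧ ‖a n k‖ < 1)
    (hK : ∀ n, ∑ k ∈ S n, (1 - ‖a n k‖) ≤ K * (1 / 4) ^ n) {R : ℝ} (hR : R < 1) :
    HasProdLocallyUniformlyOn (fun (i : Σ n, S n) z => blaschkeFactor (a i.1 i.2) z)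
      (stagedBlaschke S a) (ball 0 R) := by
  have h := Summable.hasProdLocallyUniformlyOn_one_add (K := ball (0:ℂ) R)
    (f := fun (i : Σ n, S n) z => blaschkeFactor (a i.1 i.2) z - 1) isOpen_ball
    ((summable_one_sub_norm ha hK).mul_right (2 / (1 - R)))
    (Eventually.of_forall fun i z hz => norm_blaschkeFactor_sub_one_le (ha _ _).1 (ha _ _).2 hR
      (by simpa using (mem_ball_zero_iff.1 hz).le))
    (fun i z hz => ((differentiableAt_blaschkeFactor (ha _ _).2
      ((mem_ball_zero_iff.1 hz).le.trans hR.le)).sub_const 1).continuousAt.continuousWithinAt)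
  simp only [add_sub_cancel] at h
  convert! h using 1
  ext z
  exact stagedBlaschke_eq_tprod z

lemma differentiableOn_stagedBlaschke (ha : ∀ n k, a n k ≠ 0 ∧ ‖a n k‖ < 1)
    (hK : ∀ n, ∑ k ∈ S n, (1 - ‖a n k‖) ≤ K * (1 / 4) ^ n) :
    DifferentiableOn ℂ (stagedBlaschke S a) (ball 0 1) := by
  intro z hz
  obtain ⟨R, hzR, hR⟩ := exists_between (mem_ball_zero_iff.1 hz)
  have h := (hasProdLocallyUniformlyOn_stagedBlaschke ha hK
    hR).differentiableOn (Eventually.of_forall fun s z hz => ?_) isOpen_ball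
  · exact ((h z (mem_ball_zero_iff.2 hzR)).differentiableAt
      (isOpen_ball.mem_nhds (mem_ball_zero_iff.2 hzR))).differentiableWithinAt
  · exact (DifferentiableAt.fun_finsetProd fun i _ => differentiableAt_blaschkeFactor
      (ha i.1 i.2).2 ((mem_ball_zero_iff.1 hz).le.trans hR.le)).differentiableWithinAt

lemma tendsto_stageProd (ha : ∀ n k, a n k ≠ 0 ∧ ‖a n k‖ < 1)
    (hK : ∀ n, ∑ k ∈ S n, (1 - ‖a n k‖) ≤ K * (1 / 4) ^ n) {z : ℂ} (hz : ‖z‖ < 1) :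
    Tendsto (fun n => stageProd S a n z) atTop (𝓝 (stagedBlaschke S a z)) := by
  obtain ⟨R, hzR, hR⟩ := exists_between hz
  have h := (hasProdLocallyUniformlyOn_stagedBlaschke ha hK hR).hasProd (mem_ball_zero_iff.2 hzR)
  refine (h.sigma (g := fun n => finBlaschke (S n) (a n) z) fun n => ?_).tendsto_prod_nat
  have := hasProd_fintype (fun k : S n => blaschkeFactor (a n k) z)
  rwa [Finset.prod_coe_sort (S n) fun k => blaschkeFactor (a n k) z] at this

lemma norm_stagedBlaschke_le_one (ha : ∀ n k, a n k ≠ 0 ∧ ‖a n k‖ < 1)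
    (hK : ∀ n, ∑ k ∈ S n, (1 - ‖a n k‖) ≤ K * (1 / 4) ^ n) {z : ℂ} (hz : ‖z‖ < 1) :
    ‖stagedBlaschke S a z‖ ≤ 1 :=
  le_of_tendsto (tendsto_stageProd ha hK hz).norm
    (Eventually.of_forall fun n => norm_stageProd_le_one ha n hz.le)

lemma isBlaschkeProductOn_stagedBlaschke (ha : ∀ n k, a n k ≠ 0 ∧ ‖a n k‖ < 1)
    (hK : ∀ n, ∑ k ∈ S n, (1 - ‖a n k‖) ≤ K * (1 / 4) ^ n) :
    IsBlaschkeProductOn (stagedBlaschke S a) (ball 0 1) :=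
  ⟨0, 1, Σ n, S n, inferInstance, fun i => a i.1 i.2, norm_one, fun i => ha i.1 i.2,
    summable_one_sub_norm ha hK, fun _ _ => rfl⟩

/-- The stage products converge at almost every boundary point. -/
lemma ae_exists_tendsto_stageProd (ha : ∀ n k, a n k ≠ 0 ∧ ‖a n k‖ < 1)
    (hK : ∀ n, ∑ k ∈ S n, (1 - ‖a n k‖) ≤ K * (1 / 4) ^ n) :
    ∀ᵐ θ : ℝ, ∃ L : ℂ, Tendsto (fun n => stageProd S a n (cexp (θ * I))) atTop (𝓝 L) := by
  refine ae_of_periodic (fun θ => ?_) ?_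
  · have h : cexp ((θ + 2 * π : ℝ) * I) = cexp (θ * I) := periodic_exp_ofReal_mul_I θ
    rw [h]
  have hK0 : 0 ≤ K := by
    have := (Finset.sum_nonneg fun k _ => by linarith [(ha 0 k).2]).trans (hK 0)
    simpa using this
  have hbound : ∀ n, ∫⁻ θ in Ioc (0:ℝ) (2 * π), ‖finBlaschke (S n) (a n) (cexp (θ * I)) - 1‖ₑ ≤
      ENNReal.ofReal ((π + 2 * π * K) * (1 / 2) ^ n) := by
    intro n
    refine (lintegral_finBlaschke_sub_one_le (ha n) (c := (1 / 2) ^ n) (by positivity)).trans ?_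
    apply ENNReal.ofReal_le_ofReal
    have h4 : ((1:ℝ) / 4) ^ n = (1 / 2) ^ n * (1 / 2) ^ n := by rw [← mul_pow]; norm_num
    have h2 : (0:ℝ) < (1 / 2) ^ n := by positivity
    have := hK n
    rw [h4] at this
    rw [add_mul]
    gcongr
    rw [div_le_iff₀ h2]
    nlinarith [Real.pi_pos]
  have hm : ∀ n, AEMeasurable (fun θ : ℝ => ‖finBlaschke (S n) (a n) (cexp (θ * I)) - 1‖ₑ)
      (volume.restrict (Ioc 0 (2 * π))) := fun n =>
    ((continuous_finBlaschke_exp (ha n)).sub continuous_const).enorm.measurable.aemeasurable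
  have hfin : ∫⁻ θ in Ioc (0:ℝ) (2 * π),
      ∑' n, ‖finBlaschke (S n) (a n) (cexp (θ * I)) - 1‖ₑ ≠ ⊤ := by
    rw [lintegral_tsum hm]
    refine ne_top_of_le_ne_top ?_ (ENNReal.tsum_le_tsum hbound)
    rw [← ENNReal.ofReal_tsum_of_nonneg (fun n => by positivity)]
    · exact ENNReal.ofReal_ne_top
    · exact (summable_geometric_of_lt_one (by norm_num) (by norm_num)).mul_left _
  filter_upwards [ae_lt_top' (AEMeasurable.tsum hm) hfin] with θ hθ
  have hs : Summable fun n => ‖finBlaschke (S n) (a n) (cexp (θ * I)) - 1‖ := by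
    have := ENNReal.summable_toReal hθ.ne
    simpa using this
  have hd : ∀ n, dist (stageProd S a n (cexp (θ * I))) (stageProd S a (n + 1) (cexp (θ * I))) ≤
      ‖finBlaschke (S n) (a n) (cexp (θ * I)) - 1‖ := by
    intro n
    rw [dist_comm, dist_eq_norm]
    have : stageProd S a (n + 1) (cexp (θ * I)) - stageProd S a n (cexp (θ * I)) =
        stageProd S a n (cexp (θ * I)) * (finBlaschke (S n) (a n) (cexp (θ * I)) - 1) := by
      simp only [stageProd, Finset.prod_range_succ]
      ring
    rw [this, norm_mul, norm_stageProd_eq_one ha n (norm_exp_ofReal_mul_I θ), one_mul]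
  exact cauchySeq_tendsto_of_complete (cauchySeq_of_dist_le_of_summable _ hd hs)

end Staged

/-- The Poisson integral of a bounded measurable function differs from the function by at most the
oscillation against the Cauchy kernel. -/
lemma enorm_poisson_integral_sub_le {g : ℝ → ℂ} (hg : Measurable g) {M : ℝ} (hM : ∀ t, ‖g t‖ ≤ M)
    {r : ℝ} (hr : 1 / 2 ≤ r) (hr1 : r < 1) (θ : ℝ) :
    ‖(2 * π)⁻¹ • (∫ t in (θ - π)..(θ + π), diskPoisson r (t - θ) • g t) - g θ‖ₑ ≤
      16 * cauchyOsc g (1 - r) θ := by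
  have hπ := Real.pi_pos
  have hle : θ - π ≤ θ + π := by linarith
  have hP : Continuous fun t => diskPoisson r (t - θ) :=
    (continuous_diskPoisson (by linarith) hr1).comp (continuous_id.sub continuous_const)
  have hPi : ∀ c : ℂ, IntervalIntegrable (fun t => diskPoisson r (t - θ) • c) volume
      (θ - π) (θ + π) := fun c => (hP.smul continuous_const).intervalIntegrable _ _
  have hgi : IntervalIntegrable (fun t => diskPoisson r (t - θ) • g t) volume (θ - π) (θ + π) := by
    refine (hPi M).mono_fun
      (hP.aestronglyMeasurable.smul hg.aestronglyMeasurable)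
      (Eventually.of_forall fun t => ?_)
    simp only [norm_smul, norm_real]
    gcongr
    exact (hM t).trans (le_abs_self M)
  have h1 : g θ = (2 * π)⁻¹ • ∫ t in (θ - π)..(θ + π), diskPoisson r (t - θ) • g θ := by
    rw [intervalIntegral.integral_smul_const, smul_smul, integral_diskPoisson (by linarith) hr1 θ, one_smul]
  nth_rewrite 1 [h1]
  rw [← smul_sub, ← intervalIntegral.integral_sub hgi (hPi _)]
  simp_rw [← smul_sub]
  rw [intervalIntegral.integral_of_le hle, enorm_smul]
  have h2 : ‖(2 * π)⁻¹‖ₑ ≤ 1 := by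
    rw [Real.enorm_of_nonneg (by positivity), ← ENNReal.ofReal_one]
    apply ENNReal.ofReal_le_ofReal
    rw [inv_le_one₀ (by positivity)]
    linarith [Real.pi_gt_three]
  calc _ ≤ 1 * ∫⁻ t in Ioc (θ - π) (θ + π), ‖diskPoisson r (t - θ) • (g t - g θ)‖ₑ := by
        gcongr
        exact enorm_integral_le_lintegral_enorm _
    _ = ∫⁻ t in Ioc (θ - π) (θ + π), ‖diskPoisson r (t - θ) • (g t - g θ)‖ₑ := one_mul _
    _ ≤ ∫⁻ t in Ioc (θ - π) (θ + π),
        16 * (ENNReal.ofReal ((1 - r) / ((1 - r) ^ 2 + (t - θ) ^ 2)) * ‖g t - g θ‖ₑ) := by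
        refine setLIntegral_mono' measurableSet_Ioc fun t ht => ?_
        rw [enorm_smul, ← mul_assoc]
        gcongr
        rw [Real.enorm_of_nonneg (diskPoisson_nonneg (by linarith) hr1 _)]
        rw [show (16 : ENNReal) = ENNReal.ofReal 16 by norm_num, ← ENNReal.ofReal_mul (by norm_num)]
        refine ENNReal.ofReal_le_ofReal (diskPoisson_le_cauchy hr hr1 ?_)
        rw [abs_le]
        constructor <;> linarith [ht.1, ht.2]
    _ ≤ ∫⁻ t,
        16 * (ENNReal.ofReal ((1 - r) / ((1 - r) ^ 2 + (t - θ) ^ 2)) * ‖g t - g θ‖ₑ) :=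
        setLIntegral_le_lintegral _ _
    _ = _ := by
        rw [lintegral_const_mul' _ _ (by norm_num), cauchyOsc]

section Staged
variable {S : ℕ → Finset ℕ} {a : ℕ → ℕ → ℂ} {K : ℝ}

lemma ae_tendsto_stagedBlaschke (ha : ∀ n k, a n k ≠ 0 ∧ ‖a n k‖ < 1)
    (hK : ∀ n, ∑ k ∈ S n, (1 - ‖a n k‖) ≤ K * (1 / 4) ^ n) :
    ∀ᵐ θ : ℝ, ∃ L : ℂ, ‖L‖ = 1 ∧
      Tendsto (fun r : ℝ => stagedBlaschke S a (r * cexp (θ * I))) (𝓝[<] 1) (𝓝 L) ∧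
      Tendsto (fun n => stageProd S a n (cexp (θ * I))) atTop (𝓝 L) := by
  obtain ⟨g₀, hg₀, hlim₀⟩ := measurable_limit_of_tendsto_metrizable_ae
    (fun n => (continuous_stageProd_exp (S := S) ha n).measurable.aemeasurable)
    (ae_exists_tendsto_stageProd ha hK)
  set g : ℝ → ℂ := fun θ => if ‖g₀ θ‖ = 1 then g₀ θ else 1 with hgdef
  have hg : Measurable g := Measurable.ite (measurableSet_eq_fun hg₀.norm measurable_const)
    hg₀ measurable_const
  have hg1 : ∀ θ, ‖g θ‖ = 1 := fun θ => by
    simp only [hgdef]; split_ifs with h <;> simp [h]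
  have hlim : ∀ᵐ θ : ℝ, Tendsto (fun n => stageProd S a n (cexp (θ * I))) atTop (𝓝 (g θ)) := by
    filter_upwards [hlim₀] with θ hθ
    have : ‖g₀ θ‖ = 1 := by
      refine tendsto_nhds_unique hθ.norm ?_
      simp_rw [norm_stageProd_eq_one ha _ (norm_exp_ofReal_mul_I θ)]
      exact tendsto_const_nhds
    simpa [hgdef, this] using hθ
  have hPoisson : ∀ r : ℝ, 0 ≤ r → r < 1 → ∀ θ : ℝ, stagedBlaschke S a (r * cexp (θ * I)) =
      (2 * π)⁻¹ • ∫ t in (θ - π)..(θ + π), diskPoisson r (t - θ) • g t := by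
    intro r hr hr1 θ
    have hz : ‖(r : ℂ) * cexp (θ * I)‖ < 1 := by
      rw [norm_mul, norm_exp_ofReal_mul_I, mul_one, norm_real, Real.norm_of_nonneg hr]
      exact hr1
    refine tendsto_nhds_unique (tendsto_stageProd ha hK hz) ?_
    simp_rw [poisson_formula (diffContOnCl_stageProd (S := S) ha _) hr hr1 θ]
    refine Tendsto.const_smul ?_ _
    have hP : Continuous fun t => diskPoisson r (t - θ) :=
      (continuous_diskPoisson hr hr1).comp (continuous_id.sub continuous_const)
    refine intervalIntegral.tendsto_integral_filter_of_dominated_convergence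
      (fun t => diskPoisson r (t - θ)) (Eventually.of_forall fun n => ?_)
      (Eventually.of_forall fun n => Eventually.of_forall fun t _ => ?_)
      (hP.intervalIntegrable _ _) ?_
    · exact (hP.smul (continuous_stageProd_exp ha n)).aestronglyMeasurable
    · rw [norm_smul, norm_stageProd_eq_one ha n (norm_exp_ofReal_mul_I t), mul_one,
        Real.norm_of_nonneg (diskPoisson_nonneg hr hr1 _)]
    · filter_upwards [hlim] with t ht _
      exact ht.const_smul _
  filter_upwards [hlim, ae_tendsto_cauchyOsc hg (fun t => (hg1 t).le)] with θ hθ hosc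
  refine ⟨g θ, hg1 θ, ?_, hθ⟩
  rw [tendsto_iff_edist_tendsto_0]
  have hsub : Tendsto (fun r : ℝ => 1 - r) (𝓝[<] 1) (𝓝[>] 0) := by
    refine tendsto_nhdsWithin_iff.2 ⟨?_, ?_⟩
    · have : Tendsto (fun r : ℝ => 1 - r) (𝓝 1) (𝓝 (1 - 1)) := tendsto_const_nhds.sub tendsto_id
      rw [sub_self] at this
      exact this.mono_left nhdsWithin_le_nhds
    · filter_upwards [self_mem_nhdsWithin] with r hr
      exact sub_pos.2 (mem_Iio.1 hr)
  have h16 : Tendsto (fun r : ℝ => 16 * cauchyOsc g (1 - r) θ) (𝓝[<] 1) (𝓝 0) := by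
    simpa using ENNReal.Tendsto.const_mul (hosc.comp hsub) (Or.inr (by norm_num : (16:ENNReal) ≠ ⊤))
  refine tendsto_of_tendsto_of_tendsto_of_le_of_le' tendsto_const_nhds h16
    (Eventually.of_forall fun _ => zero_le) ?_
  filter_upwards [Ioo_mem_nhdsLT (show (1 / 2 : ℝ) < 1 by norm_num)] with r hr
  rw [edist_eq_enorm_sub, hPoisson r (by linarith [hr.1]) hr.2]
  exact enorm_poisson_integral_sub_le hg (fun t => (hg1 t).le) hr.1.le hr.2 θ

lemma isInner_stagedBlaschke (ha : ∀ n k, a n k ≠ 0 ∧ ‖a n k‖ < 1)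
    (hK : ∀ n, ∑ k ∈ S n, (1 - ‖a n k‖) ≤ K * (1 / 4) ^ n) : IsInner (stagedBlaschke S a) := by
  refine ⟨differentiableOn_stagedBlaschke ha hK,
    ⟨1, fun z hz => norm_stagedBlaschke_le_one ha hK (mem_ball_zero_iff.1 hz)⟩,
    ae_restrict_of_ae ?_⟩
  filter_upwards [ae_tendsto_stagedBlaschke ha hK] with θ ⟨L, hL, h, _⟩
  exact ⟨L, hL, h⟩

end Staged

/-- The disc automorphism exchanging `0` and `ρ`. -/
noncomputable def discSwap (ρ : ℝ) (w : ℂ) : ℂ := (ρ - w) / (1 - ρ * w)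

lemma one_sub_le_norm_one_sub_mul {ρ : ℝ} (hρ : 0 ≤ ρ) {w : ℂ} (hw : ‖w‖ = 1) :
    1 - ρ ≤ ‖1 - ρ * w‖ := by
  have := norm_sub_norm_le (1:ℂ) (ρ * w)
  rwa [norm_mul, hw, norm_one, norm_real, Real.norm_of_nonneg hρ, mul_one] at this

lemma one_sub_ofReal_mul_ne_zero {ρ : ℝ} (hρ : 0 ≤ ρ) (hρ1 : ρ < 1) {w : ℂ} (hw : ‖w‖ = 1) :
    1 - ρ * w ≠ 0 :=
  norm_pos_iff.1 ((sub_pos.2 hρ1).trans_le (one_sub_le_norm_one_sub_mul hρ hw))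

lemma blaschkeFactor_ofReal_mul_exp {ρ : ℝ} (hρ : 0 < ρ) (t θ : ℝ) :
    blaschkeFactor (ρ * cexp (t * I)) (cexp (θ * I)) = discSwap ρ (cexp ((θ - t : ℝ) * I)) := by
  have hconj : (starRingEnd ℂ) (cexp (t * I)) = (cexp (t * I))⁻¹ := by
    rw [← exp_conj, ← exp_neg]; simp
  have ht := exp_ne_zero (t * I)
  rw [blaschkeFactor, discSwap, norm_mul, norm_exp_ofReal_mul_I, mul_one, norm_real,
    Real.norm_of_nonneg hρ.le, map_mul, conj_ofReal, hconj, ofReal_sub, sub_mul, exp_sub]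
  have hρ' : (ρ : ℂ) ≠ 0 := by exact_mod_cast hρ.ne'
  rw [mul_div_assoc', mul_assoc, inv_mul_eq_div]
  congr 1
  field_simp

lemma norm_discSwap {ρ : ℝ} (hρ : 0 ≤ ρ) (hρ1 : ρ < 1) {w : ℂ} (hw : ‖w‖ = 1) :
    ‖discSwap ρ w‖ = 1 := by
  have h0 := one_sub_ofReal_mul_ne_zero hρ hρ1 hw
  rw [discSwap, norm_div, div_eq_one_iff_eq (norm_ne_zero_iff.2 h0)]
  have hw' : normSq w = 1 := by rw [normSq_eq_norm_sq, hw, one_pow]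
  rw [← sq_eq_sq₀ (norm_nonneg _) (norm_nonneg _), ← normSq_eq_norm_sq, ← normSq_eq_norm_sq]
  rw [normSq_apply] at hw'
  rw [normSq_apply, normSq_apply]
  simp only [sub_re, sub_im, one_re, one_im, re_ofReal_mul, im_ofReal_mul, ofReal_re, ofReal_im]
  linear_combination (1 - ρ ^ 2) * hw'

lemma prod_range_discSwap {N : ℕ} {ζ : ℂ} (hN : 0 < N) (hζ : IsPrimitiveRoot ζ N) (ρ : ℝ) (w : ℂ) :
    ∏ k ∈ Finset.range N, discSwap ρ (ζ ^ k * w) = discSwap (ρ ^ N) (w ^ N) := by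
  have key : ∀ x y : ℂ, ∏ k ∈ Finset.range N, (x - ζ ^ k * y) = x ^ N - y ^ N := by
    intro x y
    classical
    rw [hζ.pow_sub_pow_eq_prod_sub_mul x y hN, Polynomial.nthRootsFinset_def,
      hζ.nthRoots_eq (one_pow N)]
    have hinj : InjOn (fun k => ζ ^ k) (Finset.range N : Set ℕ) := fun i hi j hj h =>
      hζ.pow_inj (Finset.mem_range.1 hi) (Finset.mem_range.1 hj) h
    rw [← Finset.prod_image (f := fun z => x - z * y) hinj]
    simp only [mul_one]
    rfl
  simp only [discSwap, Finset.prod_div_distrib, key, ofReal_pow]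
  congr 1
  have h := key 1 (ρ * w)
  rw [one_pow, mul_pow] at h
  rw [← h]
  refine Finset.prod_congr rfl fun k _ => ?_
  ring

lemma norm_discSwap_add_le {ρ : ℝ} (hρ : 0 ≤ ρ) (hρ1 : ρ < 1) {w : ℂ} (hw : ‖w‖ = 1) :
    ‖discSwap ρ w + w‖ ≤ 2 * ρ / (1 - ρ) := by
  have h0 := one_sub_ofReal_mul_ne_zero hρ hρ1 hw
  have h1 : discSwap ρ w + w = ρ * (1 - w ^ 2) / (1 - ρ * w) := by
    rw [discSwap]; field_simp; ring
  rw [h1, norm_div, norm_mul, norm_real, Real.norm_of_nonneg hρ]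
  have h2 : ‖1 - w ^ 2‖ ≤ 2 := by
    refine (norm_sub_le _ _).trans ?_
    rw [norm_pow, hw]; norm_num
  have := one_sub_le_norm_one_sub_mul hρ hw
  rw [mul_comm 2]
  gcongr

lemma norm_discSwap_div_sub_le {ρ : ℝ} (hρ : 0 ≤ ρ) (hρ1 : ρ < 1) {w u : ℂ} (hw : ‖w‖ = 1)
    (hu : ‖u‖ = 1) : ‖discSwap ρ w / discSwap ρ (w / u) - u‖ ≤ 4 * ρ / (1 - ρ) := by
  have hu0 : u ≠ 0 := norm_ne_zero_iff.1 (by rw [hu]; norm_num)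
  have hwu : ‖w / u‖ = 1 := by rw [norm_div, hw, hu, div_one]
  have hB := norm_discSwap hρ hρ1 hwu
  have hB0 : discSwap ρ (w / u) ≠ 0 := norm_ne_zero_iff.1 (by rw [hB]; norm_num)
  have h1 : discSwap ρ w / discSwap ρ (w / u) - u =
      ((discSwap ρ w + w) - u * (discSwap ρ (w / u) + w / u)) / discSwap ρ (w / u) := by
    field_simp; ring
  rw [h1, norm_div, hB, div_one]
  calc _ ≤ ‖discSwap ρ w + w‖ + ‖u * (discSwap ρ (w / u) + w / u)‖ := norm_sub_le _ _
    _ ≤ 2 * ρ / (1 - ρ) + 2 * ρ / (1 - ρ) := by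
      rw [norm_mul, hu, one_mul]
      exact add_le_add (norm_discSwap_add_le hρ hρ1 hw) (norm_discSwap_add_le hρ hρ1 hwu)
    _ = _ := by ring

lemma norm_exp_mul_I_sub_exp_mul_I_le (x y : ℝ) : ‖cexp (x * I) - cexp (y * I)‖ ≤ |x - y| := by
  have h : cexp (x * I) - cexp (y * I) = cexp (y * I) * (cexp (I * (x - y : ℝ)) - 1) := by
    rw [mul_sub, ← Complex.exp_add]; push_cast; ring_nf
  rw [h, norm_mul, norm_exp_ofReal_mul_I, one_mul]
  exact Real.norm_exp_I_mul_ofReal_sub_one_le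

lemma norm_one_sub_mul_exp_le {ρ δ : ℝ} (hρ : 0 ≤ ρ) (hρ1 : ρ < 1) (hδ : δ ≤ 1 - ρ) {x y : ℝ}
    (hxy : |x - y| ≤ π * δ) :
    ‖1 - ρ * cexp (x * I)‖ ≤ (1 + π) * ‖1 - ρ * cexp (y * I)‖ := by
  have h1 := one_sub_le_norm_one_sub_mul_exp hρ y
  have h2 : ‖1 - ρ * cexp (x * I)‖ ≤ ‖1 - ρ * cexp (y * I)‖ + |x - y| := by
    have h3 : 1 - ρ * cexp (x * I) =
        (1 - ρ * cexp (y * I)) - ρ * (cexp (x * I) - cexp (y * I)) := by ring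
    rw [h3]
    refine (norm_sub_le _ _).trans ?_
    rw [norm_mul, norm_real, Real.norm_of_nonneg hρ]
    have := norm_exp_mul_I_sub_exp_mul_I_le x y
    nlinarith [norm_nonneg (cexp (x * I) - cexp (y * I))]
  nlinarith [Real.pi_pos]

lemma norm_discSwap_sub_le {ρ δ : ℝ} (hρ : 0 ≤ ρ) (hρ1 : ρ < 1) (hδ : δ ≤ 1 - ρ) {x y y' : ℝ}
    (hy : |x - y| ≤ π * δ) (hy' : |x - y'| ≤ π * δ) :
    ‖discSwap ρ (cexp (y * I)) - discSwap ρ (cexp (y' * I))‖ ≤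
      (1 + π) ^ 2 * |y - y'| * diskPoisson ρ x := by
  have h0 := one_sub_ofReal_mul_ne_zero hρ hρ1 (norm_exp_ofReal_mul_I x)
  have h1 := one_sub_ofReal_mul_ne_zero hρ hρ1 (norm_exp_ofReal_mul_I y)
  have h2 := one_sub_ofReal_mul_ne_zero hρ hρ1 (norm_exp_ofReal_mul_I y')
  have e : discSwap ρ (cexp (y * I)) - discSwap ρ (cexp (y' * I)) =
      -((1 - ρ ^ 2 : ℝ) * (cexp (y * I) - cexp (y' * I))) /
        ((1 - ρ * cexp (y * I)) * (1 - ρ * cexp (y' * I))) := by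
    rw [discSwap, discSwap, div_sub_div _ _ h1 h2]
    congr 1
    push_cast; ring
  have hr : 0 ≤ 1 - ρ ^ 2 := by nlinarith
  rw [e, norm_div, norm_neg, norm_mul, norm_mul, norm_real, Real.norm_of_nonneg hr, diskPoisson]
  have h3 := norm_one_sub_mul_exp_le hρ hρ1 hδ hy
  have h4 := norm_one_sub_mul_exp_le hρ hρ1 hδ hy'
  have p0 := norm_pos_iff.2 h0
  have p1 := norm_pos_iff.2 h1
  have p2 := norm_pos_iff.2 h2
  have h5 := mul_le_mul h3 h4 p0.le (by positivity)
  rw [mul_div_assoc', div_le_div_iff₀ (by positivity) (by positivity)]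
  calc _ ≤ ((1 - ρ ^ 2) * |y - y'|) * ((1 + π) * ‖1 - ρ * cexp (y * I)‖ *
        ((1 + π) * ‖1 - ρ * cexp (y' * I)‖)) := by
        rw [sq ‖_‖]
        gcongr
        exact norm_exp_mul_I_sub_exp_mul_I_le y y'
    _ = _ := by ring

lemma norm_prod_sub_prod_le {ι : Type*} (s : Finset ι) {f g : ι → ℂ} (hf : ∀ i, ‖f i‖ = 1)
    (hg : ∀ i, ‖g i‖ = 1) : ‖∏ i ∈ s, f i - ∏ i ∈ s, g i‖ ≤ ∑ i ∈ s, ‖f i - g i‖ := by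
  classical
  induction s using Finset.induction_on with
  | empty => simp
  | insert i s hi ih =>
    rw [Finset.prod_insert hi, Finset.prod_insert hi, Finset.sum_insert hi]
    have h : f i * ∏ j ∈ s, f j - g i * ∏ j ∈ s, g j =
        (f i - g i) * ∏ j ∈ s, f j + g i * (∏ j ∈ s, f j - ∏ j ∈ s, g j) := by ring
    rw [h]
    refine (norm_add_le _ _).trans ?_
    rw [norm_mul, norm_mul, hg, one_mul, norm_prod, Finset.prod_eq_one fun j _ => hf j, mul_one]
    gcongr

/-- The `k`-th node of the equally spaced grid with `N` nodes starting at `s`. -/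
noncomputable def gridPoint (N : ℕ) (s : ℝ) (k : ℕ) : ℝ := 2 * π * k / N + s

lemma prod_discSwap_gridPoint {N : ℕ} (hN : 0 < N) (ρ s x : ℝ) :
    ∏ k ∈ Finset.range N, discSwap ρ (cexp ((x - gridPoint N s k : ℝ) * I)) =
      discSwap (ρ ^ N) (cexp ((N * (x - s) : ℝ) * I)) := by
  have hζ := (Complex.isPrimitiveRoot_exp N hN.ne').inv
  have h := prod_range_discSwap hN hζ ρ (cexp ((x - s : ℝ) * I))
  have h2 : cexp ((N * (x - s) : ℝ) * I) = cexp ((x - s : ℝ) * I) ^ N := by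
    rw [← Complex.exp_nat_mul]; push_cast; ring_nf
  rw [h2, ← h]
  refine Finset.prod_congr rfl fun k _ => ?_
  congr 1
  rw [← Complex.exp_neg, ← Complex.exp_nat_mul, ← Complex.exp_add]
  congr 1
  rw [gridPoint]
  push_cast
  ring

lemma norm_prod_discSwap_div_sub_le {N : ℕ} {L : ℝ} (hL : 1 ≤ L) (hN : 2 * L ≤ N) {ρ : ℝ}
    (hρ : ρ = 1 - L / N) (s θ : ℝ) {b : ℕ → ℝ} (hb : ∀ k, |b k| ≤ π) {b₀ : ℝ} (hb₀ : |b₀| ≤ π) :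
    ‖(∏ k ∈ Finset.range N, discSwap ρ (cexp ((θ - gridPoint N s k : ℝ) * I))) /
        (∏ k ∈ Finset.range N, discSwap ρ (cexp ((θ - (gridPoint N s k + b k / N) : ℝ) * I)))
      - cexp (b₀ * I)‖ ≤ 8 * Real.exp (-L) +
        ∑ k ∈ Finset.range N, (1 + π) ^ 2 / N * |b k - b₀| * diskPoisson ρ (θ - gridPoint N s k) := by
  have hN0 : (0:ℝ) < N := by linarith
  have hN0' : 0 < N := by exact_mod_cast hN0
  have hLN : L / N ≤ 1 / 2 := by rw [div_le_div_iff₀ hN0 two_pos]; linarith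
  have hLN0 : 0 < L / N := by positivity
  have hρ0 : 0 ≤ ρ := by linarith
  have hρ1 : ρ < 1 := by linarith
  have hpow : ρ ^ N ≤ Real.exp (-L) := by
    rw [hρ]; exact Real.one_sub_div_pow_le_exp_neg (by linarith)
  have hexp : Real.exp (-L) ≤ 1 / 2 := by
    have h1 : Real.exp (-L) ≤ Real.exp (-1) := Real.exp_le_exp.2 (by linarith)
    have := Real.exp_neg_one_lt_half
    linarith
  set A := ∏ k ∈ Finset.range N, discSwap ρ (cexp ((θ - gridPoint N s k : ℝ) * I)) with hA
  set B := ∏ k ∈ Finset.range N, discSwap ρ (cexp ((θ - (gridPoint N s k + b k / N) : ℝ) * I)) with hB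
  set B₀ := ∏ k ∈ Finset.range N, discSwap ρ (cexp ((θ - (gridPoint N s k + b₀ / N) : ℝ) * I)) with hB₀
  have hnorm : ∀ x : ℝ, ‖discSwap ρ (cexp (x * I))‖ = 1 := fun x =>
    norm_discSwap hρ0 hρ1 (norm_exp_ofReal_mul_I x)
  have hA1 : ‖A‖ = 1 := by rw [hA, norm_prod]; exact Finset.prod_eq_one fun k _ => hnorm _
  have hB1 : ‖B‖ = 1 := by rw [hB, norm_prod]; exact Finset.prod_eq_one fun k _ => hnorm _
  have hB₀1 : ‖B₀‖ = 1 := by rw [hB₀, norm_prod]; exact Finset.prod_eq_one fun k _ => hnorm _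
  have hB0 : B ≠ 0 := norm_ne_zero_iff.1 (by rw [hB1]; norm_num)
  have hB₀0 : B₀ ≠ 0 := norm_ne_zero_iff.1 (by rw [hB₀1]; norm_num)
  have hfirst : ‖A / B₀ - cexp (b₀ * I)‖ ≤ 8 * Real.exp (-L) := by
    have hBe : B₀ = discSwap (ρ ^ N) (cexp ((N * (θ - s) : ℝ) * I) / cexp (b₀ * I)) := by
      have h := prod_discSwap_gridPoint hN0' ρ s (θ - b₀ / N)
      have h2 : cexp ((N * (θ - b₀ / N - s) : ℝ) * I) =
          cexp ((N * (θ - s) : ℝ) * I) / cexp (b₀ * I) := by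
        rw [← Complex.exp_sub, ← sub_mul, ← ofReal_sub]
        congr 3
        field_simp
        ring
      rw [← h2, ← h, hB₀]
      refine Finset.prod_congr rfl fun k _ => ?_
      congr 4
      ring
    rw [hBe, hA, prod_discSwap_gridPoint hN0']
    have hp0 : 0 ≤ ρ ^ N := by positivity
    refine (norm_discSwap_div_sub_le hp0 (by linarith) (norm_exp_ofReal_mul_I _)
      (norm_exp_ofReal_mul_I _)).trans ?_
    rw [div_le_iff₀ (by linarith)]
    nlinarith [Real.exp_pos (-L)]
  have hsecond : ‖A / B - A / B₀‖ ≤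
      ∑ k ∈ Finset.range N, (1 + π) ^ 2 / N * |b k - b₀| * diskPoisson ρ (θ - gridPoint N s k) := by
    have h1 : A / B - A / B₀ = A * (B₀ - B) / (B * B₀) := by field_simp
    rw [h1, norm_div, norm_mul, norm_mul, hA1, hB1, hB₀1, one_mul, one_mul, div_one]
    refine (norm_prod_sub_prod_le _ (fun k => hnorm _) (fun k => hnorm _)).trans ?_
    refine Finset.sum_le_sum fun k _ => ?_
    have hδ : (N:ℝ)⁻¹ ≤ 1 - ρ := by
      rw [hρ, sub_sub_cancel, inv_eq_one_div]; gcongr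
    have hd : ∀ c : ℝ, |c| ≤ π →
        |θ - gridPoint N s k - (θ - (gridPoint N s k + c / N))| ≤ π * (N:ℝ)⁻¹ := by
      intro c hc
      rw [show θ - gridPoint N s k - (θ - (gridPoint N s k + c / N)) = c * (N:ℝ)⁻¹ by ring,
        abs_mul, abs_of_pos (inv_pos.2 hN0)]
      gcongr
    refine (norm_discSwap_sub_le hρ0 hρ1 hδ (hd b₀ hb₀) (hd (b k) (hb k))).trans (le_of_eq ?_)
    rw [show θ - (gridPoint N s k + b₀ / N) - (θ - (gridPoint N s k + b k / N)) =
      (b k - b₀) / N by ring, abs_div, abs_of_pos hN0]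
    ring
  calc ‖A / B - cexp (b₀ * I)‖ = ‖(A / B₀ - cexp (b₀ * I)) + (A / B - A / B₀)‖ := by ring_nf
    _ ≤ _ := (norm_add_le _ _).trans (add_le_add hfirst hsecond)

lemma setLIntegral_Ioc_eq_of_periodic {f : ℝ → ENNReal} (hf : Function.Periodic f (2 * π)) (c d : ℝ) :
    ∫⁻ θ in Ioc c (c + 2 * π), f θ = ∫⁻ θ in Ioc d (d + 2 * π), f θ := by
  refine (isAddFundamentalDomain_Ioc Real.two_pi_pos c).setLIntegral_eq
    (isAddFundamentalDomain_Ioc Real.two_pi_pos d) _ fun g x => ?_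
  obtain ⟨g, hg⟩ := g
  obtain ⟨n, rfl⟩ := AddSubgroup.mem_zmultiples_iff.1 hg
  have h := (hf.zsmul n) x
  rw [add_comm] at h
  exact h

lemma sum_setLIntegral_Ioc (h : ℝ → ENNReal) {d : ℝ} (hd : 0 ≤ d) (n : ℕ) :
    ∑ k ∈ Finset.range n, ∫⁻ t in Ioc (d * k) (d * (k + 1)), h t = ∫⁻ t in Ioc 0 (d * n), h t := by
  induction n with
  | zero => simp
  | succ n ih =>
    rw [Finset.sum_range_succ, ih, ← lintegral_union measurableSet_Ioc, Ioc_union_Ioc_eq_Ioc]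
    · push_cast; rfl
    · positivity
    · nlinarith
    · exact Ioc_disjoint_Ioc_of_le le_rfl

lemma exists_sum_gridPoint_le {h : ℝ → ENNReal} (hh : Measurable h) {N : ℕ} (hN : 0 < N) :
    ∃ s, ENNReal.ofReal (2 * π / N) * ∑ k ∈ Finset.range N, h (gridPoint N s k) ≤
      ∫⁻ t in Ioc 0 (2 * π), h t := by
  have hN' : (0:ℝ) < N := by exact_mod_cast hN
  set d := 2 * π / N with hd
  have hd0 : 0 < d := by positivity
  have hvol : volume (Ioc 0 d) = ENNReal.ofReal d := by simp
  have hmeas : ∀ k, Measurable fun s => h (gridPoint N s k) := fun k => by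
    unfold gridPoint; fun_prop
  obtain ⟨s, _, hs⟩ := exists_le_setLAverage (μ := volume) (s := Ioc 0 d)
    (f := fun s => ∑ k ∈ Finset.range N, h (gridPoint N s k))
    (by rw [hvol]; simpa using hd0) (by rw [hvol]; exact ENNReal.ofReal_ne_top)
    (Finset.measurable_fun_sum _ fun k _ => hmeas k).aemeasurable
  refine ⟨s, ?_⟩
  calc _ ≤ volume (Ioc 0 d) * ⨍⁻ s in Ioc 0 d, ∑ k ∈ Finset.range N, h (gridPoint N s k) ∂volume := by
        rw [hvol]; gcongr
    _ = ∫⁻ s in Ioc 0 d, ∑ k ∈ Finset.range N, h (gridPoint N s k) :=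
        measure_mul_setLAverage _ (by rw [hvol]; exact ENNReal.ofReal_ne_top)
    _ = ∑ k ∈ Finset.range N, ∫⁻ t in Ioc (d * k) (d * (k + 1)), h t := by
        rw [lintegral_finsetSum _ fun k _ => hmeas k]
        refine Finset.sum_congr rfl fun k _ => ?_
        have hg : ∀ s, gridPoint N s k = d * k + s := fun s => by rw [gridPoint, hd]; ring
        simp only [hg]
        rw [← (measurePreserving_add_left volume (d * k)).setLIntegral_comp_preimage
          measurableSet_Ioc hh]
        congr 2
        rw [preimage_const_add_Ioc]
        ring_nf
    _ = _ := by
        rw [sum_setLIntegral_Ioc h hd0.le N, hd]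
        congr 3
        field_simp

lemma measurable_cauchyOsc {f : ℝ → ℂ} (hf : Measurable f) (δ : ℝ) : Measurable (cauchyOsc f δ) := by
  unfold cauchyOsc
  refine Measurable.lintegral_prod_right'
    (f := fun p : ℝ × ℝ => ENNReal.ofReal (δ / (δ ^ 2 + (p.2 - p.1) ^ 2)) * ‖f p.2 - f p.1‖ₑ) ?_
  fun_prop

lemma tendsto_lintegral_cauchyOsc {f : ℝ → ℂ} (hf : Measurable f) {M : ℝ} (hM : ∀ t, ‖f t‖ ≤ M)
    {u : ℕ → ℝ} (hu : Tendsto u atTop (𝓝[>] 0)) (c : ℝ) :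
    Tendsto (fun n => ∫⁻ t in Ioc 0 c, cauchyOsc f (u n) t) atTop (𝓝 0) := by
  rw [← lintegral_zero (μ := volume.restrict (Ioc 0 c))]
  have hu' := hu.eventually self_mem_nhdsWithin
  refine tendsto_lintegral_filter_of_dominated_convergence
    (fun _ => ENNReal.ofReal (∑' k : ℕ, 8 / 2 ^ k * (2 * M)))
    (Eventually.of_forall fun n => measurable_cauchyOsc hf _) ?_ ?_ ?_
  · filter_upwards [hu'] with n hn
    exact Eventually.of_forall fun t => cauchyOsc_le hf hM hn t
  · simp [ENNReal.mul_eq_top]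
  · filter_upwards [ae_restrict_of_ae (ae_tendsto_cauchyOsc hf hM)] with t ht
    exact ht.comp hu

lemma periodic_diskPoisson (r t : ℝ) :
    Function.Periodic (fun θ => diskPoisson r (θ - t)) (2 * π) := fun θ => by
  have h : cexp ((θ - t + 2 * π : ℝ) * I) = cexp ((θ - t : ℝ) * I) :=
    periodic_exp_ofReal_mul_I (θ - t)
  simp only [diskPoisson]
  rw [show θ + 2 * π - t = θ - t + 2 * π by ring, h]

lemma setLIntegral_diskPoisson_mul_le {g : ℝ → ℂ} (hg : Function.Periodic g (2 * π)) {r : ℝ}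
    (hr : 1 / 2 ≤ r) (hr1 : r < 1) (t : ℝ) :
    ∫⁻ θ in Ioc 0 (2 * π), ENNReal.ofReal (diskPoisson r (θ - t)) * ‖g θ - g t‖ₑ ≤
      16 * cauchyOsc g (1 - r) t := by
  have hper : Function.Periodic
      (fun θ => ENNReal.ofReal (diskPoisson r (θ - t)) * ‖g θ - g t‖ₑ) (2 * π) := fun θ => by
    have := periodic_diskPoisson r t θ
    simp only at this
    simp only [this, hg θ]
  have h := setLIntegral_Ioc_eq_of_periodic hper 0 (t - π)
  rw [zero_add, show t - π + 2 * π = t + π by ring] at h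
  rw [h]
  calc _ ≤ ∫⁻ θ in Ioc (t - π) (t + π),
        16 * (ENNReal.ofReal ((1 - r) / ((1 - r) ^ 2 + (θ - t) ^ 2)) * ‖g θ - g t‖ₑ) := by
        refine setLIntegral_mono' measurableSet_Ioc fun θ hθ => ?_
        rw [← mul_assoc]
        gcongr
        rw [show (16 : ENNReal) = ENNReal.ofReal 16 by norm_num, ← ENNReal.ofReal_mul (by norm_num)]
        refine ENNReal.ofReal_le_ofReal (diskPoisson_le_cauchy hr hr1 ?_)
        rw [abs_le]
        constructor <;> linarith [hθ.1, hθ.2]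
    _ ≤ ∫⁻ θ,
        16 * (ENNReal.ofReal ((1 - r) / ((1 - r) ^ 2 + (θ - t) ^ 2)) * ‖g θ - g t‖ₑ) :=
        setLIntegral_le_lintegral _ _
    _ = _ := by
        rw [lintegral_const_mul' _ _ (by norm_num), cauchyOsc]

/-- A unimodular function differing from `1` on a set of measure at most `m` is close in `L¹` to a
quotient of finite Blaschke products of small mass. -/
theorem exists_finBlaschke_div_close : ∃ C : ℝ, 0 < C ∧ ∀ (L : ℝ), 1 ≤ L → ∀ ψ : ℝ → ℂ,
    Measurable ψ → (∀ θ, ‖ψ θ‖ = 1) → Function.Periodic ψ (2 * π) → ∀ m : ℝ, 0 < m →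
    volume (Ioc 0 (2 * π) ∩ {θ | ψ θ ≠ 1}) ≤ ENNReal.ofReal m →
    ∃ (S : Finset ℕ) (a a' : ℕ → ℂ),
      (∀ k, a k ≠ 0 ∧ ‖a k‖ < 1) ∧ (∀ k, a' k ≠ 0 ∧ ‖a' k‖ < 1) ∧
      ∑ k ∈ S, (1 - ‖a k‖) ≤ L * m ∧ ∑ k ∈ S, (1 - ‖a' k‖) ≤ L * m ∧
      ∫⁻ θ in Ioc 0 (2 * π),
        ‖finBlaschke S a (cexp (θ * I)) / finBlaschke S a' (cexp (θ * I)) - ψ θ‖ₑ ≤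
          ENNReal.ofReal (C * Real.exp (-L)) := by
  refine ⟨16 * π + 16 * (1 + π) ^ 2, by positivity, ?_⟩
  intro L hL ψ hψ hψ1 hper m hm hE
  have hπ := Real.pi_pos
  set β : ℝ → ℝ := fun θ => arg (ψ θ) with hβ
  set g : ℝ → ℂ := fun θ => β θ with hg
  have hβm : Measurable β := measurable_arg.comp hψ
  have hgm : Measurable g := measurable_ofReal.comp hβm
  have hβπ : ∀ θ, |β θ| ≤ π := fun θ => abs_arg_le_pi _
  have hgπ : ∀ θ, ‖g θ‖ ≤ π := fun θ => by simpa [hg] using hβπ θ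
  have hgper : Function.Periodic g (2 * π) := fun θ => by simp only [hg, hβ, hper θ]
  have hψβ : ∀ θ, cexp (β θ * I) = ψ θ := fun θ => by
    have := norm_mul_exp_arg_mul_I (ψ θ)
    rwa [hψ1, ofReal_one, one_mul] at this
  have hEm : MeasurableSet {θ | ψ θ ≠ 1} := (measurableSet_eq_fun hψ measurable_const).compl
  have hη := Real.exp_pos (-L)
  set η := Real.exp (-L)
  obtain ⟨N, hNL, hND⟩ : ∃ N : ℕ, 2 * L ≤ N ∧
      ∫⁻ t in Ioc 0 (2 * π), cauchyOsc g (L / N) t ≤ ENNReal.ofReal η := by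
    have hu : Tendsto (fun n : ℕ => L / n) atTop (𝓝[>] 0) := by
      refine tendsto_nhdsWithin_iff.2 ⟨tendsto_const_div_atTop_nhds_zero_nat L, ?_⟩
      filter_upwards [eventually_gt_atTop 0] with n hn
      have : (0:ℝ) < n := by exact_mod_cast hn
      exact mem_Ioi.2 (by positivity)
    have h1 := (tendsto_lintegral_cauchyOsc hgm hgπ hu (2 * π)).eventually_le_const
      (ENNReal.ofReal_pos.2 hη)
    have h2 := tendsto_natCast_atTop_atTop.eventually_ge_atTop (2 * L)
    obtain ⟨N, h⟩ := (h2.and h1).exists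
    exact ⟨N, h⟩
  have hN : (0:ℝ) < N := by linarith
  have hN' : 0 < N := by exact_mod_cast hN
  set ρ := 1 - L / N with hρ
  have hLN : L / N ≤ 1 / 2 := by rw [div_le_div_iff₀ hN two_pos]; linarith
  have hLN0 : 0 < L / N := by positivity
  have hρ2 : 1 / 2 ≤ ρ := by linarith
  have hρ0 : 0 < ρ := by linarith
  have hρ1 : ρ < 1 := by linarith
  have hDm := measurable_cauchyOsc hgm (L / N)
  obtain ⟨s, hs⟩ := exists_sum_gridPoint_le (N := N)
    (h := fun t => {θ | ψ θ ≠ 1}.indicator 1 t / ENNReal.ofReal m +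
      cauchyOsc g (L / N) t / ENNReal.ofReal η)
    (((measurable_one.indicator hEm).div_const _).add (hDm.div_const _)) hN'
  have hs2 : ∫⁻ t in Ioc 0 (2 * π), ({θ | ψ θ ≠ 1}.indicator 1 t / ENNReal.ofReal m +
      cauchyOsc g (L / N) t / ENNReal.ofReal η) ≤ 2 := by
    simp only [div_eq_mul_inv _ (ENNReal.ofReal _)]
    rw [lintegral_add_left ((measurable_one.indicator hEm).mul_const _),
      lintegral_mul_const _ (measurable_one.indicator hEm), lintegral_mul_const _ hDm,
      lintegral_indicator_one hEm, Measure.restrict_apply hEm, inter_comm, ← div_eq_mul_inv,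
      ← div_eq_mul_inv]
    refine (add_le_add (ENNReal.div_le_of_le_mul (b := 1) ?_)
      (ENNReal.div_le_of_le_mul (b := 1) ?_)).trans_eq one_add_one_eq_two
    · rwa [one_mul]
    · rwa [one_mul]
  set t := gridPoint N s with ht
  replace hs := hs.trans hs2
  rw [Finset.sum_add_distrib, mul_add] at hs
  have hcard := le_self_add.trans hs
  have hosc := le_add_self.trans hs
  clear hs hs2
  set S := (Finset.range N).filter fun k => ψ (t k) ≠ 1 with hS
  have hmass : (S.card : ℝ) * (L / N) ≤ L * m := by
    simp only [div_eq_mul_inv _ (ENNReal.ofReal m)] at hcard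
    rw [← Finset.sum_mul, ← mul_assoc, ← div_eq_mul_inv] at hcard
    have h1 := (ENNReal.div_le_iff_le_mul (Or.inl (by simpa using hm))
      (Or.inl ENNReal.ofReal_ne_top)).1 hcard
    have h2 : ∑ k ∈ Finset.range N, {θ | ψ θ ≠ 1}.indicator (1 : ℝ → ENNReal) (t k) =
        ENNReal.ofReal S.card := by
      rw [hS, ENNReal.ofReal_natCast, Finset.card_filter]
      push_cast
      exact Finset.sum_congr rfl fun k _ => by simp [indicator_apply]
    rw [h2, ← ENNReal.ofReal_mul (by positivity), show (2 : ENNReal) = ENNReal.ofReal 2 by norm_num,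
      ← ENNReal.ofReal_mul (by positivity), ENNReal.ofReal_le_ofReal_iff (by positivity)] at h1
    have h3 : S.card / (N:ℝ) ≤ m := by
      have : 2 * π / N * S.card = 2 * π * (S.card / (N:ℝ)) := by ring
      rw [this] at h1
      have : (0:ℝ) ≤ S.card / N := by positivity
      nlinarith [Real.pi_gt_three]
    calc (S.card : ℝ) * (L / N) = L * (S.card / N) := by ring
      _ ≤ L * m := by gcongr
  have hosc' : ENNReal.ofReal (1 / N) * ∑ k ∈ Finset.range N, cauchyOsc g (L / N) (t k) ≤
      ENNReal.ofReal η := by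
    simp only [div_eq_mul_inv _ (ENNReal.ofReal η)] at hosc
    rw [← Finset.sum_mul, ← mul_assoc, ← div_eq_mul_inv] at hosc
    have h1 := (ENNReal.div_le_iff_le_mul (Or.inl (by simpa using hη))
      (Or.inl ENNReal.ofReal_ne_top)).1 hosc
    rw [show (2 : ENNReal) = ENNReal.ofReal 2 by norm_num,
      show 2 * π / N = 2 * (π / N) by ring, ENNReal.ofReal_mul two_pos.le, mul_assoc,
      ENNReal.mul_le_mul_iff_right (by simp) ENNReal.ofReal_ne_top] at h1
    refine le_trans ?_ h1
    gcongr
    linarith [Real.pi_gt_three]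
  have hmod : ∀ x : ℝ, ‖(ρ * cexp (x * I) : ℂ)‖ = ρ := fun x => by
    rw [norm_mul, norm_exp_ofReal_mul_I, mul_one, norm_real, Real.norm_of_nonneg hρ0.le]
  have hzero : ∀ x : ℝ, (ρ * cexp (x * I) : ℂ) ≠ 0 := fun x =>
    norm_ne_zero_iff.1 (by rw [hmod]; exact hρ0.ne')
  refine ⟨S, fun k => ρ * cexp (t k * I), fun k => ρ * cexp ((t k + β (t k) / N : ℝ) * I),
    fun k => ⟨hzero _, by rw [hmod]; exact hρ1⟩, fun k => ⟨hzero _, by rw [hmod]; exact hρ1⟩,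
    ?_, ?_, ?_⟩
  · simp only [hmod, Finset.sum_const, nsmul_eq_mul]
    rwa [hρ, sub_sub_cancel]
  · simp only [hmod, Finset.sum_const, nsmul_eq_mul]
    rwa [hρ, sub_sub_cancel]
  have hratio : ∀ θ : ℝ, finBlaschke S (fun k => ρ * cexp (t k * I)) (cexp (θ * I)) /
      finBlaschke S (fun k => ρ * cexp ((t k + β (t k) / N : ℝ) * I)) (cexp (θ * I)) =
      (∏ k ∈ Finset.range N, discSwap ρ (cexp ((θ - t k : ℝ) * I))) /
        (∏ k ∈ Finset.range N, discSwap ρ (cexp ((θ - (t k + β (t k) / N) : ℝ) * I))) := by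
    intro θ
    simp only [finBlaschke, blaschkeFactor_ofReal_mul_exp hρ0]
    rw [← Finset.prod_div_distrib, ← Finset.prod_div_distrib]
    refine Finset.prod_subset (Finset.filter_subset _ _) fun k hk hkS => ?_
    have hk1 : ψ (t k) = 1 := by
      by_contra h
      exact hkS (Finset.mem_filter.2 ⟨hk, h⟩)
    have hb : β (t k) = 0 := by simp [hβ, hk1]
    rw [hb, zero_div, add_zero]
    exact div_self (norm_ne_zero_iff.1
      (by rw [norm_discSwap hρ0.le hρ1 (norm_exp_ofReal_mul_I _)]; norm_num))
  have hpt : ∀ θ : ℝ, ‖finBlaschke S (fun k => ρ * cexp (t k * I)) (cexp (θ * I)) /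
      finBlaschke S (fun k => ρ * cexp ((t k + β (t k) / N : ℝ) * I)) (cexp (θ * I)) - ψ θ‖ₑ ≤
      ENNReal.ofReal (8 * η) + ∑ k ∈ Finset.range N, ENNReal.ofReal ((1 + π) ^ 2 / N) *
        (ENNReal.ofReal (diskPoisson ρ (θ - t k)) * ‖g θ - g (t k)‖ₑ) := by
    intro θ
    rw [hratio, ← hψβ θ, ← ofReal_norm]
    refine (ENNReal.ofReal_le_ofReal (norm_prod_discSwap_div_sub_le hL hNL hρ s θ
      (b := fun k => β (t k)) (fun k => hβπ _) (hβπ θ))).trans ?_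
    have hP := fun k => diskPoisson_nonneg hρ0.le hρ1 (θ - t k)
    rw [ENNReal.ofReal_add (by positivity)
      (Finset.sum_nonneg fun k _ => mul_nonneg (by positivity) (hP k)),
      ENNReal.ofReal_sum_of_nonneg fun k _ => mul_nonneg (by positivity) (hP k)]
    refine add_le_add le_rfl (Finset.sum_le_sum fun k _ => le_of_eq ?_)
    have hgb : ‖g θ - g (t k)‖ = |β (t k) - β θ| := by
      rw [hg, ← ofReal_sub, norm_real, Real.norm_eq_abs, abs_sub_comm]
    rw [← ofReal_norm, hgb, ← ENNReal.ofReal_mul (hP k), ← ENNReal.ofReal_mul (by positivity)]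
    congr 1
    ring
  have hfm : ∀ k, Measurable fun θ =>
      ENNReal.ofReal (diskPoisson ρ (θ - t k)) * ‖g θ - g (t k)‖ₑ := fun k =>
    ((continuous_diskPoisson hρ0.le hρ1).measurable.comp
      (measurable_id.sub_const _)).ennreal_ofReal.mul (hgm.sub_const _).enorm
  calc _ ≤ ∫⁻ θ in Ioc 0 (2 * π), (ENNReal.ofReal (8 * η) +
        ∑ k ∈ Finset.range N, ENNReal.ofReal ((1 + π) ^ 2 / N) *
        (ENNReal.ofReal (diskPoisson ρ (θ - t k)) * ‖g θ - g (t k)‖ₑ)) :=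
        lintegral_mono fun θ => hpt θ
    _ = ENNReal.ofReal (8 * η) * ENNReal.ofReal (2 * π) +
        ∑ k ∈ Finset.range N, ENNReal.ofReal ((1 + π) ^ 2 / N) *
        ∫⁻ θ in Ioc 0 (2 * π), ENNReal.ofReal (diskPoisson ρ (θ - t k)) * ‖g θ - g (t k)‖ₑ := by
        rw [lintegral_add_left measurable_const,
          lintegral_finsetSum _ fun k _ => (hfm k).const_mul _]
        simp only [lintegral_const_mul _ (hfm _)]
        simp
    _ ≤ ENNReal.ofReal (8 * η) * ENNReal.ofReal (2 * π) +
        ∑ k ∈ Finset.range N, ENNReal.ofReal ((1 + π) ^ 2 / N) * (16 * cauchyOsc g (L / N) (t k)) := by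
        gcongr with k _
        have := setLIntegral_diskPoisson_mul_le hgper hρ2 hρ1 (t k)
        rwa [hρ, sub_sub_cancel, ← hρ] at this
    _ = ENNReal.ofReal (8 * η) * ENNReal.ofReal (2 * π) + ENNReal.ofReal (16 * (1 + π) ^ 2) *
        (ENNReal.ofReal (1 / N) * ∑ k ∈ Finset.range N, cauchyOsc g (L / N) (t k)) := by
        congr 1
        rw [← mul_assoc, ← ENNReal.ofReal_mul (by positivity), Finset.mul_sum]
        refine Finset.sum_congr rfl fun k _ => ?_
        rw [show (16 : ENNReal) = ENNReal.ofReal 16 by norm_num, ← mul_assoc,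
          ← ENNReal.ofReal_mul (by positivity)]
        congr 2
        ring
    _ ≤ ENNReal.ofReal (8 * η) * ENNReal.ofReal (2 * π) + ENNReal.ofReal (16 * (1 + π) ^ 2) *
        ENNReal.ofReal η := by gcongr
    _ = _ := by
        rw [← ENNReal.ofReal_mul (by positivity), ← ENNReal.ofReal_mul (by positivity),
          ← ENNReal.ofReal_add (by positivity) (by positivity)]
        congr 1
        ring

/-- Measurable, unimodular and `2π`-periodic functions on the line. -/
structure IsPeriodicUnimodular (χ : ℝ → ℂ) : Prop where
  measurable : Measurable χ
  norm_eq_one : ∀ θ, ‖χ θ‖ = 1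
  periodic : Function.Periodic χ (2 * π)

lemma IsPeriodicUnimodular.div {χ χ' : ℝ → ℂ} (h : IsPeriodicUnimodular χ)
    (h' : IsPeriodicUnimodular χ') : IsPeriodicUnimodular fun θ => χ θ / χ' θ :=
  ⟨h.measurable.div h'.measurable, fun θ => by rw [norm_div, h.norm_eq_one, h'.norm_eq_one, div_one],
    fun θ => by simp only [h.periodic θ, h'.periodic θ]⟩

lemma isPeriodicUnimodular_finBlaschke {S : Finset ℕ} {a : ℕ → ℂ} (ha : ∀ k, a k ≠ 0 ∧ ‖a k‖ < 1) :
    IsPeriodicUnimodular fun θ => finBlaschke S a (cexp (θ * I)) :=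
  ⟨(continuous_finBlaschke_exp ha).measurable,
    fun θ => norm_finBlaschke_eq_one ha (norm_exp_ofReal_mul_I θ),
    fun θ => congrArg (finBlaschke S a) (periodic_exp_ofReal_mul_I θ)⟩

/-- One correction step: if `χ` is within `e` of `1` off a set of measure at most `m`, dividing it by
a quotient of finite Blaschke products brings it within `e + d` of `1` off a much smaller set. -/
lemma exists_finBlaschke_correction : ∃ C : ℝ, 0 < C ∧ ∀ (L : ℝ), 1 ≤ L → ∀ χ : ℝ → ℂ,
    IsPeriodicUnimodular χ → ∀ e d m : ℝ, 0 ≤ e → 0 < d → 0 < m →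
    volume.restrict (Ioc 0 (2 * π)) {θ | e ≤ ‖χ θ - 1‖} ≤ ENNReal.ofReal m →
    ∃ (S : Finset ℕ) (a a' : ℕ → ℂ),
      (∀ k, a k ≠ 0 ∧ ‖a k‖ < 1) ∧ (∀ k, a' k ≠ 0 ∧ ‖a' k‖ < 1) ∧
      ∑ k ∈ S, (1 - ‖a k‖) ≤ L * m ∧ ∑ k ∈ S, (1 - ‖a' k‖) ≤ L * m ∧
      volume.restrict (Ioc 0 (2 * π)) {θ | e + d ≤ ‖χ θ /
        (finBlaschke S a (cexp (θ * I)) / finBlaschke S a' (cexp (θ * I))) - 1‖} ≤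
        ENNReal.ofReal (C * Real.exp (-L) / d) := by
  obtain ⟨C, hC, hstage⟩ := exists_finBlaschke_div_close
  refine ⟨C, hC, fun L hL χ hχ e d m he hd hm hE => ?_⟩
  set ψ : ℝ → ℂ := fun θ => if e ≤ ‖χ θ - 1‖ then χ θ else 1 with hψ
  have hEm : MeasurableSet {θ | e ≤ ‖χ θ - 1‖} :=
    measurableSet_le measurable_const (hχ.measurable.sub_const 1).norm
  have hψm : Measurable ψ := Measurable.ite hEm hχ.measurable measurable_const
  have hψ1 : ∀ θ, ‖ψ θ‖ = 1 := fun θ => by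
    simp only [hψ]; split_ifs <;> simp [hχ.norm_eq_one]
  have hψp : Function.Periodic ψ (2 * π) := fun θ => by simp only [hψ, hχ.periodic θ]
  have hψχ : ∀ θ, ‖χ θ - ψ θ‖ ≤ e := fun θ => by
    simp only [hψ]
    split_ifs with h
    · simpa using he
    · exact (not_le.1 h).le
  have hsupp : volume (Ioc 0 (2 * π) ∩ {θ | ψ θ ≠ 1}) ≤ ENNReal.ofReal m := by
    refine le_trans ?_ hE
    rw [Measure.restrict_apply hEm, inter_comm]
    refine measure_mono (inter_subset_inter_left _ fun θ hθ => ?_)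
    by_contra h
    exact hθ (if_neg h)
  obtain ⟨S, a, a', ha, ha', hS, hS', hint⟩ := hstage L hL ψ hψm hψ1 hψp m hm hsupp
  refine ⟨S, a, a', ha, ha', hS, hS', ?_⟩
  have hR := (isPeriodicUnimodular_finBlaschke (S := S) ha).div
    (isPeriodicUnimodular_finBlaschke (S := S) ha')
  set R : ℝ → ℂ := fun θ => finBlaschke S a (cexp (θ * I)) / finBlaschke S a' (cexp (θ * I))
  have hsub : {θ | e + d ≤ ‖χ θ / R θ - 1‖} ⊆ {θ | ENNReal.ofReal d ≤ ‖R θ - ψ θ‖ₑ} := by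
    intro θ hθ
    have hR0 : R θ ≠ 0 := norm_ne_zero_iff.1 (by rw [hR.norm_eq_one]; norm_num)
    have h1 : ‖χ θ / R θ - 1‖ = ‖χ θ - R θ‖ := by
      rw [div_sub_one hR0, norm_div, hR.norm_eq_one, div_one]
    have h2 : ‖χ θ - R θ‖ ≤ ‖χ θ - ψ θ‖ + ‖R θ - ψ θ‖ := by
      rw [norm_sub_rev (R θ)]
      exact norm_sub_le_norm_sub_add_norm_sub _ _ _
    have h3 : e + d ≤ ‖χ θ / R θ - 1‖ := hθ
    have h4 := hψχ θ
    rw [mem_ofPred_eq, ← ofReal_norm]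
    exact ENNReal.ofReal_le_ofReal (by linarith)
  refine (measure_mono hsub).trans ?_
  rw [ENNReal.ofReal_div_of_pos hd]
  refine (meas_ge_le_lintegral_div (hR.measurable.sub hψm).enorm.aemeasurable
    (by simpa using hd) ENNReal.ofReal_ne_top).trans ?_
  exact ENNReal.div_le_div_right hint _

/-- Iterated corrections. -/
lemma exists_staged_correction {φ : ℝ → ℂ} (hφ : IsPeriodicUnimodular φ) {ε : ℝ} (hε : 0 < ε) :
    ∃ (S : ℕ → Finset ℕ) (a a' : ℕ → ℕ → ℂ) (K M : ℝ),
      (∀ n k, a n k ≠ 0 ∧ ‖a n k‖ < 1) ∧ (∀ n k, a' n k ≠ 0 ∧ ‖a' n k‖ < 1) ∧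
      (∀ n, ∑ k ∈ S n, (1 - ‖a n k‖) ≤ K * (1 / 4) ^ n) ∧
      (∀ n, ∑ k ∈ S n, (1 - ‖a' n k‖) ≤ K * (1 / 4) ^ n) ∧
      ∀ n, volume.restrict (Ioc 0 (2 * π)) {θ | ε ≤ ‖φ θ /
        (stageProd S a n (cexp (θ * I)) / stageProd S a' n (cexp (θ * I))) - 1‖} ≤
        ENNReal.ofReal (M * (1 / 8) ^ n) := by
  obtain ⟨C, hC, hstep⟩ := exists_finBlaschke_correction
  set M := 2 * π + C / ε with hM
  have hM0 : 0 < M := by have := Real.pi_pos; positivity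
  have hlog : 1 ≤ Real.log 16 := by
    rw [Real.le_log_iff_exp_le (by norm_num)]
    have := Real.exp_one_lt_d9
    linarith
  set e : ℕ → ℝ := fun n => ε * (1 - (1 / 2) ^ n) with he
  have he0 : ∀ n, 0 ≤ e n := fun n =>
    mul_nonneg hε.le (sub_nonneg.2 (pow_le_one₀ (by norm_num) (by norm_num)))
  let P : ℕ → (ℝ → ℂ) → Prop := fun n χ => IsPeriodicUnimodular χ ∧
    volume.restrict (Ioc 0 (2 * π)) {θ | e n ≤ ‖χ θ - 1‖} ≤ ENNReal.ofReal (M * (1 / 8) ^ n)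
  have hP0 : P 0 φ := by
    refine ⟨hφ, (measure_mono (subset_univ _)).trans ?_⟩
    rw [Measure.restrict_apply_univ, Real.volume_Ioc, pow_zero, mul_one, sub_zero]
    exact ENNReal.ofReal_le_ofReal (le_add_of_nonneg_right (by positivity))
  have hPstep : ∀ (n : ℕ) (χ : {χ // P n χ}), ∃ (S : Finset ℕ) (a a' : ℕ → ℂ),
      (∀ k, a k ≠ 0 ∧ ‖a k‖ < 1) ∧ (∀ k, a' k ≠ 0 ∧ ‖a' k‖ < 1) ∧
      ∑ k ∈ S, (1 - ‖a k‖) ≤ Real.log 16 * M * (1 / 4) ^ n ∧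
      ∑ k ∈ S, (1 - ‖a' k‖) ≤ Real.log 16 * M * (1 / 4) ^ n ∧
      P (n + 1) fun θ => χ.1 θ /
        (finBlaschke S a (cexp (θ * I)) / finBlaschke S a' (cexp (θ * I))) := by
    rintro n ⟨χ, hχ, hE⟩
    have hn : (1:ℝ) ≤ n + 1 := by linarith [(Nat.cast_nonneg n : (0:ℝ) ≤ n)]
    obtain ⟨S, a, a', ha, ha', hS, hS', hv⟩ := hstep ((n + 1) * Real.log 16)
      (one_le_mul_of_one_le_of_one_le hn hlog) χ hχ (e n) (ε * (1 / 2) ^ (n + 1)) (M * (1 / 8) ^ n)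
      (he0 n) (by positivity) (by positivity) hE
    have hmass : (n + 1) * Real.log 16 * (M * (1 / 8) ^ n) ≤ Real.log 16 * M * (1 / 4) ^ n := by
      have h2 : ((n:ℝ) + 1) ≤ 2 ^ n := by exact_mod_cast Nat.lt_two_pow_self
      have h8 : ((1:ℝ) / 4) ^ n = 2 ^ n * (1 / 8) ^ n := by rw [← mul_pow]; norm_num
      rw [h8]
      calc _ = Real.log 16 * M * ((n + 1) * (1 / 8) ^ n) := by ring
        _ ≤ _ := by gcongr
    refine ⟨S, a, a', ha, ha', hS.trans hmass, hS'.trans hmass, ?_, ?_⟩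
    · exact hχ.div ((isPeriodicUnimodular_finBlaschke ha).div (isPeriodicUnimodular_finBlaschke ha'))
    · have hen : e n + ε * (1 / 2) ^ (n + 1) = e (n + 1) := by simp only [he]; ring
      rw [hen] at hv
      refine hv.trans (ENNReal.ofReal_le_ofReal ?_)
      have hexp : Real.exp (-((n + 1) * Real.log 16)) = (1 / 8) ^ (n + 1) * (1 / 2) ^ (n + 1) := by
        rw [Real.exp_neg, show ((n:ℝ) + 1) * Real.log 16 = ((n + 1 : ℕ) : ℝ) * Real.log 16 by
          push_cast; ring, Real.exp_nat_mul, Real.exp_log (by norm_num), ← mul_pow, ← inv_pow]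
        norm_num
      rw [hexp]
      have : C * ((1 / 8) ^ (n + 1) * (1 / 2) ^ (n + 1)) / (ε * (1 / 2) ^ (n + 1)) =
          C / ε * (1 / 8) ^ (n + 1) := by field_simp
      rw [this]
      gcongr
      exact le_add_of_nonneg_left (by positivity)
  choose S a a' ha ha' hS hS' hP using hPstep
  let χ : ∀ n, {χ // P n χ} := fun n => Nat.rec (motive := fun n => {χ // P n χ})
    ⟨φ, hP0⟩ (fun n χ => ⟨_, hP n χ⟩) n
  have hχ : ∀ n θ, (χ n).1 θ = φ θ / (stageProd (fun n => S n (χ n)) (fun n => a n (χ n)) n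
      (cexp (θ * I)) / stageProd (fun n => S n (χ n)) (fun n => a' n (χ n)) n (cexp (θ * I))) := by
    intro n θ
    induction n with
    | zero => simp [stageProd, χ]
    | succ n ih =>
      have h : (χ (n + 1)).1 θ = (χ n).1 θ / (finBlaschke (S n (χ n)) (a n (χ n)) (cexp (θ * I)) /
        finBlaschke (S n (χ n)) (a' n (χ n)) (cexp (θ * I))) := rfl
      rw [h, ih]
      simp only [stageProd, Finset.prod_range_succ]
      rw [div_div, div_mul_div_comm]
  refine ⟨fun n => S n (χ n), fun n => a n (χ n), fun n => a' n (χ n), Real.log 16 * M, M,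
    fun n => ha n (χ n), fun n => ha' n (χ n), fun n => hS n (χ n), fun n => hS' n (χ n), fun n => ?_⟩
  refine (measure_mono fun θ hθ => ?_).trans (χ n).2.2
  rw [mem_ofPred_eq] at hθ ⊢
  rw [hχ]
  refine le_trans ?_ hθ
  have : (0:ℝ) < (1 / 2) ^ n := by positivity
  simp only [he]
  nlinarith

lemma exists_isPeriodicUnimodular_ae_eq {φ : ℝ → ℂ}
    (hmeas : AEStronglyMeasurable φ (volume.restrict (Ioc (0:ℝ) (2 * π))))
    (hφ : ∀ᵐ θ ∂(volume.restrict (Ioc (0:ℝ) (2 * π))), ‖φ θ‖ = 1) :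
    ∃ χ, IsPeriodicUnimodular χ ∧ φ =ᵐ[volume.restrict (Ioc (0:ℝ) (2 * π))] χ := by
  have hmk := hmeas.stronglyMeasurable_mk.measurable
  have h2π := Real.two_pi_pos
  set f := hmeas.mk φ
  set g : ℝ → ℂ := fun θ => if ‖f θ‖ = 1 then f θ else 1 with hg
  have hgm : Measurable g :=
    Measurable.ite (measurableSet_eq_fun hmk.norm measurable_const) hmk measurable_const
  have hg1 : ∀ θ, ‖g θ‖ = 1 := fun θ => by
    simp only [hg]; split_ifs with h <;> simp [h]
  refine ⟨fun θ => g (2 * π * Int.fract (θ / (2 * π))), ⟨?_, fun θ => hg1 _, fun θ => ?_⟩, ?_⟩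
  · exact hgm.comp ((measurable_fract.comp (measurable_id.div_const _)).const_mul _)
  · simp only [add_div, div_self h2π.ne', Int.fract_add_one]
  · have hne : ∀ᵐ θ : ℝ ∂(volume.restrict (Ioc (0:ℝ) (2 * π))), θ ≠ 2 * π :=
      ae_restrict_of_ae (Measure.ae_ne volume _)
    filter_upwards [hmeas.ae_eq_mk, hφ, hne, ae_restrict_mem measurableSet_Ioc] with θ h1 h2 h3 h4
    have h5 : Int.fract (θ / (2 * π)) = θ / (2 * π) := by
      rw [Int.fract_eq_self]
      exact ⟨div_nonneg h4.1.le h2π.le, (div_lt_one h2π).2 (lt_of_le_of_ne h4.2 h3)⟩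
    rw [h5, mul_div_cancel₀ _ h2π.ne']
    have h6 : ‖f θ‖ = 1 := by rw [← h2, h1]
    simp only [hg, h6, if_true]
    exact h1

/-- **Douglas–Rudin theorem.** Every measurable unimodular function on the unit circle can be
approximated in `L^∞` by quotients of (boundary values of) inner functions, which may moreover
be taken to be Blaschke products. -/
theorem douglas_rudin (φ : ℝ → ℂ)
    (hmeas : AEStronglyMeasurable φ (volume.restrict (Set.Ioc (0:ℝ) (2*π))))
    (hφ : ∀ᵐ (θ : ℝ) ∂(volume.restrict (Set.Ioc (0:ℝ) (2*π))), ‖φ θ‖ = 1)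
    (ε : ℝ) (hε : 0 < ε) :
    ∃ ω₁ ω₂ : ℂ → ℂ,
      IsInner ω₁ ∧ IsInner ω₂ ∧
      IsBlaschkeProductOn ω₁ (ball (0:ℂ) 1) ∧ IsBlaschkeProductOn ω₂ (ball (0:ℂ) 1) ∧
      ∀ᵐ (θ : ℝ) ∂(volume.restrict (Set.Ioc (0:ℝ) (2*π))),
        ∃ L₁ L₂ : ℂ, ‖L₁‖ = 1 ∧ ‖L₂‖ = 1 ∧
          Tendsto (fun r : ℝ => ω₁ ((r : ℂ) * Complex.exp ((θ : ℂ) * Complex.I)))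
            (𝓝[<] (1:ℝ)) (𝓝 L₁) ∧
          Tendsto (fun r : ℝ => ω₂ ((r : ℂ) * Complex.exp ((θ : ℂ) * Complex.I)))
            (𝓝[<] (1:ℝ)) (𝓝 L₂) ∧
          ‖φ θ - L₁ / L₂‖ < ε := by
  obtain ⟨χ, hχ, hφχ⟩ := exists_isPeriodicUnimodular_ae_eq hmeas hφ
  obtain ⟨S, a, a', K, M, ha, ha', hK, hK', hE⟩ := exists_staged_correction hχ (half_pos hε)
  refine ⟨stagedBlaschke S a, stagedBlaschke S a', isInner_stagedBlaschke ha hK,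
    isInner_stagedBlaschke ha' hK', isBlaschkeProductOn_stagedBlaschke ha hK,
    isBlaschkeProductOn_stagedBlaschke ha' hK', ?_⟩
  have hsum : ∑' n, volume.restrict (Ioc 0 (2 * π)) {θ | ε / 2 ≤ ‖χ θ /
      (stageProd S a n (cexp (θ * I)) / stageProd S a' n (cexp (θ * I))) - 1‖} ≠ ⊤ := by
    refine ne_top_of_le_ne_top ?_ (ENNReal.tsum_le_tsum hE)
    exact ((summable_geometric_of_lt_one (by norm_num) (by norm_num)).mul_left M).tsum_ofReal_ne_top
  filter_upwards [hφχ, ae_eventually_notMem hsum,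
    ae_restrict_of_ae (ae_tendsto_stagedBlaschke ha hK),
    ae_restrict_of_ae (ae_tendsto_stagedBlaschke ha' hK')]
    with θ hθ hev ⟨L₁, hL₁, hr₁, hn₁⟩ ⟨L₂, hL₂, hr₂, hn₂⟩
  refine ⟨L₁, L₂, hL₁, hL₂, hr₁, hr₂, ?_⟩
  have hL₁0 : L₁ ≠ 0 := norm_ne_zero_iff.1 (by rw [hL₁]; norm_num)
  have hL₂0 : L₂ ≠ 0 := norm_ne_zero_iff.1 (by rw [hL₂]; norm_num)
  have hlim : Tendsto (fun n => ‖χ θ /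
      (stageProd S a n (cexp (θ * I)) / stageProd S a' n (cexp (θ * I))) - 1‖) atTop
      (𝓝 ‖χ θ / (L₁ / L₂) - 1‖) :=
    ((tendsto_const_nhds.div (hn₁.div hn₂ hL₂0) (div_ne_zero hL₁0 hL₂0)).sub_const 1).norm
  have hle : ‖χ θ / (L₁ / L₂) - 1‖ ≤ ε / 2 := by
    refine le_of_tendsto hlim ?_
    filter_upwards [hev] with n hn
    exact (not_le.1 hn).le
  rw [div_sub_one (div_ne_zero hL₁0 hL₂0), norm_div, norm_div L₁, hL₁, hL₂, div_one, div_one] at hle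
  rw [hθ]
  linarith
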